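/- arXiv:1009.2535 — 5 statements merged into one kernel-verified Lean document; each statement's English description precedes it below -/
import Mathlib

section
/- Let V be a finite-dimensional complex inner product space and let x, y be unitary operators on V. Then age(x) + age(y) − age(xy) + dim V^{x,y} − dim V^{xy} ≥ 0, where V^{x,y} is the subspace of vectors fixed by both x and y, and V^{xy} is the subspace of vectors fixed by xy. -/
open scoped Real

/-- The age of a unitary matrix: if its eigenvalues, with multiplicity (the roots of
its characteristic polynomial), are `e^{2πi r_1}, …, e^{2πi r_n}` with `0 ≤ r_j < 1`,
then `age(g) = Σ_j r_j`; the angle `r` of a unit complex number `z = e^{2πi r}`,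
`0 ≤ r < 1`, is `Int.fract (arg z / (2π))`. -/
noncomputable def matAge {n : ℕ} (g : Matrix (Fin n) (Fin n) ℂ) : ℝ :=
  (g.charpoly.roots.map (fun z => Int.fract (z.arg / (2 * π)))).sum

/-- The fixed-point subspace `V^g = {v : g v = v}` of a matrix `g` acting on `ℂⁿ`. -/
noncomputable def fixedSpace {n : ℕ} (g : Matrix (Fin n) (Fin n) ℂ) :
    Submodule ℂ (Fin n → ℂ) :=
  LinearMap.ker (Matrix.toLin' (g - 1))

section

open scoped Matrix

/-- Unitary matrices are unitarily diagonalizable. -/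
theorem exists_unitary_mul_diagonal {n : ℕ} (x : Matrix (Fin n) (Fin n) ℂ)
    (hx : x ∈ Matrix.unitaryGroup (Fin n) ℂ) :
    ∃ U ∈ Matrix.unitaryGroup (Fin n) ℂ, ∃ d : Fin n → ℂ,
      x = U * Matrix.diagonal d * star U := by
  set T : Module.End ℂ (EuclideanSpace ℂ (Fin n)) := x.toEuclideanLin with hT
  have hin : ∀ v w, inner ℂ (T v) (T w) = inner ℂ v w := by
    intro v w
    have h1 : star x * x = 1 := Matrix.mem_unitaryGroup_iff'.1 hx
    simp only [EuclideanSpace.inner_eq_star_dotProduct, hT, Matrix.toLpLin_apply,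
      Matrix.star_mulVec]
    rw [dotProduct_comm, ← Matrix.dotProduct_mulVec, Matrix.mulVec_mulVec,
      ← Matrix.star_eq_conjTranspose, h1, Matrix.one_mulVec, dotProduct_comm]
  have hnorm : ∀ (μ : ℂ) v, T v = μ • v → v ≠ 0 → star μ * μ = 1 := by
    intro μ v hv h0
    have h := hin v v
    rw [hv, inner_smul_left, inner_smul_right, ← mul_assoc] at h
    exact mul_right_cancel₀ (inner_self_ne_zero.2 h0) (by simpa using h)
  have horth : OrthogonalFamily ℂ (fun μ : Module.End.Eigenvalues T => Module.End.eigenspace T μ)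
      (fun μ => (Module.End.eigenspace T μ).subtypeₗᵢ) := by
    apply OrthogonalFamily.of_pairwise
    intro ν μ hμν w hw v hv
    rw [Module.End.mem_eigenspace_iff] at hv hw
    by_cases h0 : v = 0
    · simp [h0]
    have h1 := hnorm _ v hv h0
    have h := hin v w
    rw [hv, hw, inner_smul_left, inner_smul_right] at h
    by_contra hne
    apply hμν.symm
    apply Subtype.ext
    have h2 : star (μ : ℂ) * ν = 1 :=
      mul_right_cancel₀ hne (by rw [one_mul, mul_assoc]; exact h)
    have h3 : star (μ : ℂ) ≠ 0 := fun h => by simp [h] at h1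
    exact mul_left_cancel₀ h3 (h1.trans h2.symm)
  have htop : (⨆ μ : Module.End.Eigenvalues T, Module.End.eigenspace T μ)ᗮ = ⊥ := by
    set K := (⨆ μ : Module.End.Eigenvalues T, Module.End.eigenspace T μ)ᗮ with hK
    have hmem : ∀ v, v ∈ K ↔ ∀ (μ : ℂ) w, T w = μ • w → inner ℂ w v = 0 := by
      intro v
      rw [hK, ← Submodule.iInf_orthogonal, Submodule.mem_iInf]
      constructor
      · intro h μ w hw
        by_cases h0 : w = 0
        · simp [h0]
        · exact (Submodule.mem_orthogonal _ _).1
            (h ⟨μ, Module.End.hasEigenvalue_of_hasEigenvector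
              ⟨Module.End.mem_eigenspace_iff.2 hw, h0⟩⟩) w (Module.End.mem_eigenspace_iff.2 hw)
      · intro h μ
        exact (Submodule.mem_orthogonal _ _).2
          fun w hw => h μ w (Module.End.mem_eigenspace_iff.1 hw)
    have hinv : ∀ v ∈ K, T v ∈ K := by
      intro v hv
      rw [hmem] at hv ⊢
      intro μ w hw
      by_cases h0 : w = 0
      · simp [h0]
      have h := hin w v
      rw [hv μ w hw, hw, inner_smul_left] at h
      refine (mul_eq_zero.1 h).resolve_left fun h1 => ?_
      have := hnorm μ w hw h0
      rw [← starRingEnd_apply, h1] at this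
      simp at this
    by_contra hne
    have : Nontrivial K := Submodule.nontrivial_iff_ne_bot.2 hne
    obtain ⟨μ, hμ⟩ := Module.End.exists_eigenvalue (T.restrict hinv)
    obtain ⟨v, hv⟩ := hμ.exists_hasEigenvector
    have h1 : T v = μ • (v : EuclideanSpace ℂ (Fin n)) :=
      congrArg Subtype.val (hv.apply_eq_smul)
    have h2 := (hmem v).1 v.2 μ v h1
    exact hv.2 (Subtype.ext (inner_self_eq_zero.1 h2))
  have hint : DirectSum.IsInternal (fun μ : Module.End.Eigenvalues T =>
      Module.End.eigenspace T (μ : ℂ)) := horth.isInternal_iff.2 htop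
  have hfin : Module.finrank ℂ (EuclideanSpace ℂ (Fin n)) = n := by simp
  let b := hint.subordinateOrthonormalBasis hfin horth
  let d : Fin n → ℂ := fun j =>
    (hint.subordinateOrthonormalBasisIndex hfin j horth : Module.End.Eigenvalues T)
  have hb : ∀ j, T (b j) = d j • b j := fun j => Module.End.mem_eigenspace_iff.1
    (hint.subordinateOrthonormalBasis_subordinate hfin j horth)
  let U : Matrix (Fin n) (Fin n) ℂ := Matrix.of fun i j => b j i
  have hU : star U * U = 1 := by
    ext i j
    have h := orthonormal_iff_ite.1 b.orthonormal i j
    rw [EuclideanSpace.inner_eq_star_dotProduct, dotProduct_comm] at h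
    rw [Matrix.one_apply, ← h]
    rfl
  have hU' : U * star U = 1 := mul_eq_one_comm.1 hU
  refine ⟨U, Matrix.mem_unitaryGroup_iff.2 hU', d, ?_⟩
  have hxU : x * U = U * Matrix.diagonal d := by
    ext i j
    have h := congrArg (fun v : EuclideanSpace ℂ (Fin n) => v i) (hb j)
    simp only [PiLp.smul_apply, smul_eq_mul] at h
    rw [Matrix.mul_diagonal, mul_comm]
    exact h
  rw [← hxU, mul_assoc, hU', mul_one]

/-- The matrix with orthonormal eigenvectors the columns of `U` and eigenvalues `e^{2πi r_j}`. -/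
noncomputable def ofAngles {n : ℕ} (U : Matrix (Fin n) (Fin n) ℂ) (r : Fin n → ℝ) :
    Matrix (Fin n) (Fin n) ℂ :=
  U * Matrix.diagonal (fun j => Complex.exp (2 * π * r j * Complex.I)) * star U

theorem exp_two_pi_mul_fract (t : ℝ) :
    Complex.exp (2 * π * (Int.fract t : ℝ) * Complex.I) = Complex.exp (2 * π * t * Complex.I) := by
  rw [Complex.exp_eq_exp_iff_exists_int]
  refine ⟨-⌊t⌋, ?_⟩
  have h : ((Int.fract t : ℝ) : ℂ) = t - (⌊t⌋ : ℤ) := by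
    rw [← Int.self_sub_floor]; push_cast; rfl
  rw [h]; push_cast; ring

theorem exp_two_pi_mul_fract_arg {z : ℂ} (hz : ‖z‖ = 1) :
    Complex.exp (2 * π * (Int.fract (z.arg / (2 * π)) : ℝ) * Complex.I) = z := by
  rw [exp_two_pi_mul_fract]
  have h := Complex.norm_mul_exp_arg_mul_I z
  rw [hz] at h
  have hpi : (π : ℂ) ≠ 0 := by exact_mod_cast Real.pi_ne_zero
  rw [Complex.ofReal_one, one_mul] at h
  refine Eq.trans ?_ h
  congr 1
  push_cast
  field_simp

theorem exists_int_sub_of_exp_eq {a b : ℝ}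
    (h : Complex.exp (2 * π * a * Complex.I) = Complex.exp (2 * π * b * Complex.I)) :
    ∃ m : ℤ, a = b + m := by
  rw [Complex.exp_eq_exp_iff_exists_int] at h
  obtain ⟨m, hm⟩ := h
  refine ⟨m, ?_⟩
  have h2 : (2 * π * Complex.I) * (a : ℂ) = (2 * π * Complex.I) * ((b : ℂ) + m) := by
    linear_combination hm
  have h3 := mul_left_cancel₀ Complex.two_pi_I_ne_zero h2
  exact_mod_cast h3

theorem fract_arg_exp {r : ℝ} (h0 : 0 ≤ r) (h1 : r < 1) :
    Int.fract ((Complex.exp (2 * π * r * Complex.I)).arg / (2 * π)) = r := by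
  have hn : ‖Complex.exp (2 * π * r * Complex.I)‖ = 1 := by
    have := Complex.norm_exp_ofReal_mul_I (2 * π * r)
    push_cast at this; exact this
  obtain ⟨m, hm⟩ := exists_int_sub_of_exp_eq (exp_two_pi_mul_fract_arg hn)
  set f := Int.fract ((Complex.exp (2 * π * r * Complex.I)).arg / (2 * π)) with hf
  have hf0 : 0 ≤ f := Int.fract_nonneg _
  have hf1 : f < 1 := Int.fract_lt_one _
  have hm1 : (m : ℝ) < 1 := by linarith
  have hm2 : (-1 : ℝ) < m := by linarith
  have : m = 0 := by
    have h1 : m < 1 := by exact_mod_cast hm1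
    have h2 : -1 < m := by exact_mod_cast hm2
    omega
  simpa [this] using hm

section

variable {n : ℕ} {U : Matrix (Fin n) (Fin n) ℂ}

theorem exists_ofAngles_eq {x : Matrix (Fin n) (Fin n) ℂ}
    (hx : x ∈ Matrix.unitaryGroup (Fin n) ℂ) :
    ∃ U ∈ Matrix.unitaryGroup (Fin n) ℂ, ∃ r : Fin n → ℝ,
      (∀ j, 0 ≤ r j ∧ r j < 1) ∧ x = ofAngles U r := by
  obtain ⟨U, hU, d, rfl⟩ := exists_unitary_mul_diagonal x hx
  have hU1 : star U * U = 1 := Matrix.mem_unitaryGroup_iff'.1 hU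
  have hD : Matrix.diagonal d ∈ Matrix.unitaryGroup (Fin n) ℂ := by
    have h := mul_mem (mul_mem (Unitary.star_mem hU) hx) hU
    have h2 : star U * (U * Matrix.diagonal d * star U) * U = Matrix.diagonal d := by
      calc _ = (star U * U) * Matrix.diagonal d * (star U * U) := by simp only [mul_assoc]
        _ = _ := by simp [hU1]
    rwa [h2] at h
  have hd : ∀ j, ‖d j‖ = 1 := by
    intro j
    have h := congrFun (congrFun (Matrix.mem_unitaryGroup_iff.1 hD) j) j
    rw [Matrix.star_eq_conjTranspose, Matrix.diagonal_conjTranspose,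
      Matrix.diagonal_mul_diagonal] at h
    simp only [Matrix.diagonal_apply_eq, Matrix.one_apply_eq, Pi.star_apply] at h
    have h2 := congrArg norm h
    rw [norm_mul, norm_star, norm_one] at h2
    nlinarith [norm_nonneg (d j)]
  refine ⟨U, hU, fun j => Int.fract ((d j).arg / (2 * π)),
    fun j => ⟨Int.fract_nonneg _, Int.fract_lt_one _⟩, ?_⟩
  simp only [ofAngles, exp_two_pi_mul_fract_arg (hd _)]

theorem ofAngles_mul (hU : U ∈ Matrix.unitaryGroup (Fin n) ℂ) (r s : Fin n → ℝ) :
    ofAngles U r * ofAngles U s = ofAngles U (r + s) := by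
  have hU1 : star U * U = 1 := Matrix.mem_unitaryGroup_iff'.1 hU
  simp only [ofAngles]
  calc _ = U * (Matrix.diagonal (fun j => Complex.exp (2 * π * r j * Complex.I)) * (star U * U) *
        Matrix.diagonal (fun j => Complex.exp (2 * π * s j * Complex.I))) * star U := by
        simp only [mul_assoc]
    _ = _ := by
      rw [hU1, mul_one, Matrix.diagonal_mul_diagonal]
      simp only [← Complex.exp_add, Pi.add_apply]
      congr 4 with j
      congr 1
      push_cast; ring

theorem ofAngles_zero (hU : U ∈ Matrix.unitaryGroup (Fin n) ℂ) : ofAngles U 0 = 1 := by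
  have hU1 : U * star U = 1 := Matrix.mem_unitaryGroup_iff.1 hU
  simp [ofAngles, hU1]

theorem ofAngles_mem (hU : U ∈ Matrix.unitaryGroup (Fin n) ℂ) (r : Fin n → ℝ) :
    ofAngles U r ∈ Matrix.unitaryGroup (Fin n) ℂ := by
  refine mul_mem (mul_mem hU ?_) (Unitary.star_mem hU)
  rw [Matrix.mem_unitaryGroup_iff, Matrix.star_eq_conjTranspose, Matrix.diagonal_conjTranspose,
      Matrix.diagonal_mul_diagonal, ← Matrix.diagonal_one]
  congr 1
  ext j
  simp only [Pi.star_apply, Complex.star_def, ← Complex.exp_conj, ← Complex.exp_add]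
  simp [map_ofNat]

theorem matAge_ofAngles (hU : U ∈ Matrix.unitaryGroup (Fin n) ℂ) {r : Fin n → ℝ}
    (hr : ∀ j, 0 ≤ r j ∧ r j < 1) : matAge (ofAngles U r) = ∑ j, r j := by
  have hU1 : star U * U = 1 := Matrix.mem_unitaryGroup_iff'.1 hU
  have h : (ofAngles U r).charpoly.roots =
      Finset.univ.val.map (fun j => Complex.exp (2 * π * r j * Complex.I)) := by
    rw [ofAngles, Matrix.charpoly_mul_comm, ← mul_assoc, hU1, one_mul, Matrix.charpoly_diagonal]
    have := Polynomial.roots_multiset_prod_X_sub_C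
      (Finset.univ.val.map fun j => Complex.exp (2 * π * r j * Complex.I))
    rwa [Multiset.map_map] at this
  rw [matAge, h, Multiset.map_map]
  exact Finset.sum_congr rfl fun j _ => fract_arg_exp (hr j).1 (hr j).2

theorem det_ofAngles (hU : U ∈ Matrix.unitaryGroup (Fin n) ℂ) (r : Fin n → ℝ) :
    (ofAngles U r).det = Complex.exp (2 * π * (∑ j, r j : ℝ) * Complex.I) := by
  have hU1 : star U * U = 1 := Matrix.mem_unitaryGroup_iff'.1 hU
  rw [ofAngles, Matrix.det_mul_comm, ← mul_assoc, hU1, one_mul, Matrix.det_diagonal,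
    ← Complex.exp_sum]
  push_cast
  rw [Finset.mul_sum, Finset.sum_mul]

theorem mem_fixedSpace {g : Matrix (Fin n) (Fin n) ℂ} {v : Fin n → ℂ} :
    v ∈ fixedSpace g ↔ g.mulVec v = v := by
  simp [fixedSpace, sub_eq_zero]

theorem exp_two_pi_mul_eq_one_iff {r : ℝ} (h0 : 0 ≤ r) (h1 : r < 1) :
    Complex.exp (2 * π * r * Complex.I) = 1 ↔ r = 0 := by
  refine ⟨fun h => ?_, fun h => by simp [h]⟩
  have := fract_arg_exp h0 h1
  rw [h] at this
  simpa using this.symm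

theorem finrank_fixedSpace_ofAngles (hU : U ∈ Matrix.unitaryGroup (Fin n) ℂ) {r : Fin n → ℝ}
    (hr : ∀ j, 0 ≤ r j ∧ r j < 1) :
    Module.finrank ℂ (fixedSpace (ofAngles U r)) = (Finset.univ.filter fun j => r j = 0).card := by
  have hU1 : star U * U = 1 := Matrix.mem_unitaryGroup_iff'.1 hU
  have hU2 : U * star U = 1 := Matrix.mem_unitaryGroup_iff.1 hU
  have h1 : ofAngles U r - 1 =
      U * Matrix.diagonal (fun j => Complex.exp (2 * π * r j * Complex.I) - 1) * star U := by
    have : Matrix.diagonal (fun j => Complex.exp (2 * π * r j * Complex.I) - 1) =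
        Matrix.diagonal (fun j => Complex.exp (2 * π * r j * Complex.I)) - 1 := by
      rw [← Matrix.diagonal_one, Matrix.diagonal_sub]
    rw [this, ofAngles, mul_sub, sub_mul, mul_one, hU2]
  have hdet : IsUnit U.det := (Matrix.isUnit_iff_isUnit_det _).1 (IsUnit.of_mul_eq_one _ hU2)
  have hdet' : IsUnit (star U).det :=
    (Matrix.isUnit_iff_isUnit_det _).1 (IsUnit.of_mul_eq_one _ hU1)
  have h2 : (ofAngles U r - 1).rank = (Finset.univ.filter fun j => ¬ r j = 0).card := by
    rw [h1, Matrix.rank_mul_eq_left_of_isUnit_det _ _ hdet',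
      Matrix.rank_mul_eq_right_of_isUnit_det _ _ hdet, Matrix.rank_diagonal, Fintype.card_subtype]
    congr 1
    ext j
    simp [sub_eq_zero, exp_two_pi_mul_eq_one_iff (hr j).1 (hr j).2]
  have h3 := LinearMap.finrank_range_add_finrank_ker (Matrix.toLin' (ofAngles U r - 1))
  have h4 := Finset.card_filter_add_card_filter_not (s := (Finset.univ : Finset (Fin n)))
    (fun j => r j = 0)
  rw [Matrix.toLin'_apply', ← Matrix.rank, h2, Module.finrank_fin_fun] at h3
  rw [fixedSpace, Matrix.toLin'_apply']
  simp only [Finset.card_univ, Fintype.card_fin] at h4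
  omega

theorem star_dotProduct_ofAngles_mulVec (r : Fin n → ℝ) (v : Fin n → ℂ) :
    star v ⬝ᵥ (ofAngles U r).mulVec v =
      ∑ j, Complex.exp (2 * π * r j * Complex.I) * (‖(star U).mulVec v j‖ ^ 2 : ℝ) := by
  have h : star v ᵥ* U = star ((star U).mulVec v) := by
    rw [Matrix.star_mulVec, Matrix.star_eq_conjTranspose, Matrix.conjTranspose_conjTranspose]
  rw [ofAngles, ← Matrix.mulVec_mulVec, ← Matrix.mulVec_mulVec, Matrix.dotProduct_mulVec, h,
    dotProduct]
  refine Finset.sum_congr rfl fun j _ => ?_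
  rw [Matrix.mulVec_diagonal, Pi.star_apply, mul_left_comm, Complex.star_def, Complex.conj_mul']
  push_cast
  rfl

theorem sum_sin_mul_sin_mul_norm_sq (hU : U ∈ Matrix.unitaryGroup (Fin n) ℂ) (r : Fin n → ℝ)
    (s : ℝ) (v : Fin n → ℂ) :
    ∑ j, Real.sin (π * (r j - s)) * Real.sin (π * r j) * ‖(star U).mulVec v j‖ ^ 2 =
      (Real.cos (π * s) * (star v ⬝ᵥ v).re -
        (Complex.exp (-(π * s) * Complex.I) * (star v ⬝ᵥ (ofAngles U r).mulVec v)).re) / 2 := by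
  have h0 : star v ⬝ᵥ v = ∑ j, ((‖(star U).mulVec v j‖ ^ 2 : ℝ) : ℂ) := by
    have := star_dotProduct_ofAngles_mulVec (U := U) 0 v
    rw [ofAngles_zero hU, Matrix.one_mulVec] at this
    simpa using this
  rw [h0, star_dotProduct_ofAngles_mulVec, Finset.mul_sum, Complex.re_sum, Complex.re_sum,
    Finset.mul_sum, ← Finset.sum_sub_distrib, Finset.sum_div]
  refine Finset.sum_congr rfl fun j _ => ?_
  rw [← mul_assoc, Complex.re_mul_ofReal, Complex.ofReal_re, ← Complex.exp_add]
  have h1 : -((π : ℂ) * s) * Complex.I + 2 * π * r j * Complex.I =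
      ((π * (r j - s) + π * r j : ℝ) : ℂ) * Complex.I := by
    push_cast; ring
  rw [h1, Complex.exp_ofReal_mul_I_re]
  have h2 : π * s = π * r j - π * (r j - s) := by ring
  rw [h2, Real.cos_sub, Real.cos_add]
  ring

end

/-- Layer-cake comparison: a bound on the counting functions gives a bound on the sums. -/
theorem sum_le_sum_add_of_card_le {ι : Type*} [Fintype ι] {f g : ι → ℝ} {k : ℕ}
    (hf : ∀ j, 0 ≤ f j ∧ f j ≤ 1) (hg : ∀ j, 0 ≤ g j ∧ g j ≤ 1)
    (h : ∀ s : ℝ, 0 ≤ s → s < 1 → (Finset.univ.filter fun j => s < f j).card ≤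
      (Finset.univ.filter fun j => s < g j).card + k) :
    ∑ j, f j ≤ ∑ j, g j + k := by
  have key : ∀ a : ℝ, 0 ≤ a → a ≤ 1 →
      ∫ s in Set.Ico (0 : ℝ) 1, (Set.Iio a).indicator (1 : ℝ → ℝ) s = a := by
    intro a h0 h1
    rw [MeasureTheory.integral_indicator_one measurableSet_Iio,
      MeasureTheory.measureReal_restrict_apply measurableSet_Iio,
      show Set.Iio a ∩ Set.Ico 0 1 = Set.Ico 0 a by
        ext s; simp only [Set.mem_inter_iff, Set.mem_Iio, Set.mem_Ico]
        constructor
        · rintro ⟨h2, h3, -⟩; exact ⟨h3, h2⟩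
        · rintro ⟨h2, h3⟩; exact ⟨h3, h2, h3.trans_le h1⟩,
      Real.volume_real_Ico_of_le h0, sub_zero]
  have hint : ∀ a : ℝ, MeasureTheory.IntegrableOn
      ((Set.Iio a).indicator (1 : ℝ → ℝ)) (Set.Ico (0 : ℝ) 1) := fun a =>
    (MeasureTheory.integrable_const (1 : ℝ)).indicator measurableSet_Iio
  have hsum : ∀ f : ι → ℝ, (∀ j, 0 ≤ f j ∧ f j ≤ 1) →
      ∑ j, f j = ∫ s in Set.Ico (0 : ℝ) 1, ∑ j, (Set.Iio (f j)).indicator (1 : ℝ → ℝ) s := by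
    intro f hf
    rw [MeasureTheory.integral_finsetSum _ fun j _ => hint (f j)]
    exact Finset.sum_congr rfl fun j _ => (key _ (hf j).1 (hf j).2).symm
  have hcard : ∀ (f : ι → ℝ) (s : ℝ), ∑ j, (Set.Iio (f j)).indicator (1 : ℝ → ℝ) s =
      (Finset.univ.filter fun j => s < f j).card := by
    intro f s
    simp [Set.indicator_apply]
  have hk : ∫ s in Set.Ico (0 : ℝ) 1, (k : ℝ) = k := by simp
  rw [hsum f hf, hsum g hg]
  rw [← hk]
  have hi : ∀ f : ι → ℝ, MeasureTheory.IntegrableOn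
      (fun s => ∑ j, (Set.Iio (f j)).indicator (1 : ℝ → ℝ) s) (Set.Ico (0 : ℝ) 1) :=
    fun f => MeasureTheory.integrable_finsetSum _ fun j _ => hint (f j)
  rw [← MeasureTheory.integral_add (hi g) (MeasureTheory.integrable_const _)]
  refine MeasureTheory.setIntegral_mono_on (hi f)
    ((hi g).add (MeasureTheory.integrable_const _)) measurableSet_Ico fun s hs => ?_
  rw [hcard, hcard]
  exact_mod_cast h s hs.1 hs.2

section

variable {n : ℕ}

/-- If two unitary matrices agree on the kernel of a linear functional, the numbers of their
eigenvalues in the arc from `e^{2πi s}` to `1` are comparable, where the eigenvalue `1` of `g` is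
given the angle `1` and that of `y` the angle `0`. -/
theorem card_angles_le {y g U W : Matrix (Fin n) (Fin n) ℂ}
    (hU : U ∈ Matrix.unitaryGroup (Fin n) ℂ) (hW : W ∈ Matrix.unitaryGroup (Fin n) ℂ)
    {θ φ : Fin n → ℝ} (hθ : ∀ j, 0 ≤ θ j ∧ θ j < 1) (hφ : ∀ j, 0 ≤ φ j ∧ φ j < 1)
    (hy : y = ofAngles U θ) (hg : g = ofAngles W φ) (l : (Fin n → ℂ) →ₗ[ℂ] ℂ)
    (hl : ∀ v, l v = 0 → g.mulVec v = y.mulVec v) (K : Submodule ℂ (Fin n → ℂ))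
    (hK : ∀ v, l v = 0 → y.mulVec v = v → v ∈ K) {s : ℝ} (hs0 : 0 ≤ s) (hs1 : s < 1) :
    (Finset.univ.filter fun j => s < if φ j = 0 then 1 else φ j).card ≤
      (Finset.univ.filter fun j => s < θ j).card + (1 + Module.finrank ℂ K) := by
  let P : Fin n → Prop := fun j => s < if φ j = 0 then 1 else φ j
  let L : (Fin n → ℂ) →ₗ[ℂ] ({j // ¬ P j} → ℂ) × ({j // s < θ j} → ℂ) × ℂ :=
    ((LinearMap.funLeft ℂ ℂ Subtype.val).comp (Matrix.toLin' (star W))).prod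
      (((LinearMap.funLeft ℂ ℂ Subtype.val).comp (Matrix.toLin' (star U))).prod l)
  have hker : LinearMap.ker L ≤ K := by
    intro v hv
    have hv' : L v = 0 := hv
    have hc : ∀ j, ¬ P j → (star W).mulVec v j = 0 := fun j hj =>
      congrFun (congrArg Prod.fst hv') ⟨j, hj⟩
    have hb : ∀ j, s < θ j → (star U).mulVec v j = 0 := fun j hj =>
      congrFun (congrArg (fun p => p.2.1) hv') ⟨j, hj⟩
    have hlv : l v = 0 := congrArg (fun p => p.2.2) hv'
    refine hK v hlv ?_
    have hgy := hl v hlv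
    have e1 := sum_sin_mul_sin_mul_norm_sq hU θ s v
    have e2 := sum_sin_mul_sin_mul_norm_sq hW φ s v
    rw [← hg, hgy, hy, ← e1] at e2
    have hneg : ∑ j, Real.sin (π * (θ j - s)) * Real.sin (π * θ j) *
        ‖(star U).mulVec v j‖ ^ 2 ≤ 0 := by
      refine Finset.sum_nonpos fun j _ => ?_
      by_cases hj : s < θ j
      · simp [hb j hj]
      · have hθj := hθ j
        refine mul_nonpos_of_nonpos_of_nonneg (mul_nonpos_of_nonpos_of_nonneg ?_ ?_) (sq_nonneg _)
        · apply Real.sin_nonpos_of_nonpos_of_neg_pi_le <;> nlinarith [Real.pi_pos]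
        · apply Real.sin_nonneg_of_nonneg_of_le_pi <;> nlinarith [Real.pi_pos]
    have hpos : ∀ j, φ j ≠ 0 → P j →
        0 < Real.sin (π * (φ j - s)) * Real.sin (π * φ j) := by
      intro j hj hP
      simp only [P, if_neg hj] at hP
      have hφj := hφ j
      have h0 : 0 < φ j := lt_of_le_of_ne hφj.1 (Ne.symm hj)
      apply mul_pos <;> apply Real.sin_pos_of_pos_of_lt_pi <;> nlinarith [Real.pi_pos]
    have hnn : ∀ j ∈ Finset.univ, 0 ≤ Real.sin (π * (φ j - s)) * Real.sin (π * φ j) *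
        ‖(star W).mulVec v j‖ ^ 2 := by
      intro j _
      by_cases hj : φ j = 0
      · simp [hj]
      by_cases hP : P j
      · exact mul_nonneg (hpos j hj hP).le (sq_nonneg _)
      · simp [hc j hP]
    have hz := (Finset.sum_eq_zero_iff_of_nonneg hnn).1
      (le_antisymm (e2.trans_le hneg) (Finset.sum_nonneg hnn))
    have hzero : ∀ j, φ j ≠ 0 → (star W).mulVec v j = 0 := by
      intro j hj
      by_cases hP : P j
      · have := (mul_eq_zero.1 (hz j (Finset.mem_univ _))).resolve_left (hpos j hj hP).ne'
        simpa using this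
      · exact hc j hP
    have hD : (Matrix.diagonal fun j => Complex.exp (2 * π * φ j * Complex.I)).mulVec
        ((star W).mulVec v) = (star W).mulVec v := by
      ext j
      rw [Matrix.mulVec_diagonal]
      by_cases hj : φ j = 0
      · simp [hj]
      · simp [hzero j hj]
    rw [← hgy, hg, ofAngles, ← Matrix.mulVec_mulVec, ← Matrix.mulVec_mulVec, hD,
      Matrix.mulVec_mulVec, Matrix.mem_unitaryGroup_iff.1 hW, Matrix.one_mulVec]
  have h1 := LinearMap.finrank_range_add_finrank_ker L
  have h2 := Submodule.finrank_le (LinearMap.range L)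
  have h3 := Submodule.finrank_mono hker
  have h4 := Finset.card_filter_add_card_filter_not (s := (Finset.univ : Finset (Fin n))) P
  rw [Module.finrank_prod, Module.finrank_prod, Module.finrank_fintype_fun_eq_card,
    Module.finrank_fintype_fun_eq_card, Module.finrank_self, Fintype.card_subtype,
    Fintype.card_subtype] at h2
  rw [Module.finrank_fin_fun] at h1
  simp only [Finset.card_univ, Fintype.card_fin] at h4
  change (Finset.univ.filter P).card ≤ _
  omega

theorem matAge_add_finrank_le_of_agree {y g : Matrix (Fin n) (Fin n) ℂ}
    (hy : y ∈ Matrix.unitaryGroup (Fin n) ℂ) (hg : g ∈ Matrix.unitaryGroup (Fin n) ℂ)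
    (l : (Fin n → ℂ) →ₗ[ℂ] ℂ) (hl : ∀ v, l v = 0 → g.mulVec v = y.mulVec v)
    (K : Submodule ℂ (Fin n → ℂ)) (hK : ∀ v, l v = 0 → y.mulVec v = v → v ∈ K) :
    matAge g + Module.finrank ℂ (fixedSpace g) ≤ matAge y + (1 + Module.finrank ℂ K : ℕ) := by
  obtain ⟨U, hU, θ, hθ, hyU⟩ := exists_ofAngles_eq hy
  obtain ⟨W, hW, φ, hφ, hgW⟩ := exists_ofAngles_eq hg
  have h := sum_le_sum_add_of_card_le (f := fun j => if φ j = 0 then 1 else φ j) (g := θ)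
    (k := 1 + Module.finrank ℂ K)
    (fun j => by
      have := hφ j
      split_ifs
      · norm_num
      · exact ⟨this.1, this.2.le⟩)
    (fun j => ⟨(hθ j).1, (hθ j).2.le⟩)
    (fun s hs0 hs1 => card_angles_le hU hW hθ hφ hyU hgW l hl K hK hs0 hs1)
  have h2 : ∑ j, (if φ j = 0 then 1 else φ j) =
      ∑ j, φ j + ((Finset.univ.filter fun j => φ j = 0).card : ℝ) := by
    rw [← Finset.sum_boole, ← Finset.sum_add_distrib]
    refine Finset.sum_congr rfl fun j _ => ?_
    split_ifs with hj <;> simp [hj]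
  rw [hyU, hgW, matAge_ofAngles hU hθ, matAge_ofAngles hW hφ, finrank_fixedSpace_ofAngles hW hφ,
    ← h2]
  exact h

theorem exp_matAge {x : Matrix (Fin n) (Fin n) ℂ} (hx : x ∈ Matrix.unitaryGroup (Fin n) ℂ) :
    Complex.exp (2 * π * matAge x * Complex.I) = x.det := by
  obtain ⟨U, hU, r, hr, rfl⟩ := exists_ofAngles_eq hx
  rw [matAge_ofAngles hU hr, det_ofAngles hU]

/-- The Chen–Ruan inequality when the second factor is a complex reflection. -/
theorem matAge_mul_reflection_le {y U : Matrix (Fin n) (Fin n) ℂ}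
    (hy : y ∈ Matrix.unitaryGroup (Fin n) ℂ) (hU : U ∈ Matrix.unitaryGroup (Fin n) ℂ)
    (k : Fin n) {a : ℝ} (ha0 : 0 < a) :
    matAge (y * ofAngles U (Pi.single k a)) +
        Module.finrank ℂ (fixedSpace (y * ofAngles U (Pi.single k a))) ≤
      matAge y + a +
        Module.finrank ℂ ↥(fixedSpace y ⊓ fixedSpace (ofAngles U (Pi.single k a))) := by
  set r := ofAngles U (Pi.single k a) with hr
  have hrm : r ∈ Matrix.unitaryGroup (Fin n) ℂ := ofAngles_mem hU _
  have hfix : ∀ v, (star U).mulVec v k = 0 → r.mulVec v = v := by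
    intro v hv
    have hD : (Matrix.diagonal fun j => Complex.exp
        (2 * π * ((Pi.single k a : Fin n → ℝ) j : ℝ) * Complex.I)).mulVec
        ((star U).mulVec v) = (star U).mulVec v := by
      ext j
      rw [Matrix.mulVec_diagonal]
      by_cases hj : j = k
      · subst hj; rw [hv, mul_zero]
      · simp [hj]
    rw [hr, ofAngles, ← Matrix.mulVec_mulVec, ← Matrix.mulVec_mulVec, hD,
      Matrix.mulVec_mulVec, Matrix.mem_unitaryGroup_iff.1 hU, Matrix.one_mulVec]
  have hle := matAge_add_finrank_le_of_agree hy (mul_mem hy hrm)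
    ((LinearMap.proj k).comp (Matrix.toLin' (star U)))
    (fun v hv => by rw [← Matrix.mulVec_mulVec, hfix v hv]) (fixedSpace y ⊓ fixedSpace r)
    (fun v hv hv' => ⟨mem_fixedSpace.2 hv', mem_fixedSpace.2 (hfix v hv)⟩)
  have hdet : Complex.exp (2 * π * matAge (y * r) * Complex.I) =
      Complex.exp (2 * π * (matAge y + a : ℝ) * Complex.I) := by
    rw [exp_matAge (mul_mem hy hrm), Matrix.det_mul, ← exp_matAge hy, hr, det_ofAngles hU,
      ← Complex.exp_add, Finset.sum_pi_single']
    simp only [Finset.mem_univ, if_true]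
    congr 1
    push_cast; ring
  obtain ⟨m, hm⟩ := exists_int_sub_of_exp_eq hdet
  rw [hm] at hle ⊢
  have h1 : (m : ℝ) + Module.finrank ℂ (fixedSpace (y * r)) <
      1 + Module.finrank ℂ ↥(fixedSpace y ⊓ fixedSpace r) := by
    push_cast at hle
    linarith
  have h2 : m + Module.finrank ℂ (fixedSpace (y * r)) <
      1 + Module.finrank ℂ ↥(fixedSpace y ⊓ fixedSpace r) := by exact_mod_cast h1
  have h3 : m + Module.finrank ℂ (fixedSpace (y * r)) ≤
      Module.finrank ℂ ↥(fixedSpace y ⊓ fixedSpace r) := by omega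
  have h4 : (m : ℝ) + Module.finrank ℂ (fixedSpace (y * r)) ≤
      Module.finrank ℂ ↥(fixedSpace y ⊓ fixedSpace r) := by exact_mod_cast h3
  linarith

/-- The Chen–Ruan inequality when the second factor is a product of commuting complex
reflections, by induction on their number. -/
theorem matAge_mul_add_finrank_le {x U : Matrix (Fin n) (Fin n) ℂ}
    (hx : x ∈ Matrix.unitaryGroup (Fin n) ℂ) (hU : U ∈ Matrix.unitaryGroup (Fin n) ℂ)
    {θ : Fin n → ℝ} (hθ : ∀ j, 0 ≤ θ j ∧ θ j < 1) (S : Finset (Fin n)) :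
    matAge (x * ofAngles U (∑ k ∈ S, Pi.single k (θ k))) +
        Module.finrank ℂ (fixedSpace (x * ofAngles U (∑ k ∈ S, Pi.single k (θ k)))) ≤
      matAge x + ∑ k ∈ S, θ k +
        Module.finrank ℂ
          ↥(fixedSpace x ⊓ fixedSpace (ofAngles U (∑ k ∈ S, Pi.single k (θ k)))) := by
  induction S using Finset.induction_on with
  | empty =>
    have : fixedSpace (1 : Matrix (Fin n) (Fin n) ℂ) = ⊤ := by
      ext v; simp [mem_fixedSpace]
    rw [Finset.sum_empty, Finset.sum_empty, ofAngles_zero hU, mul_one, this, inf_top_eq, add_zero]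
  | insert k S hk ih =>
    rw [Finset.sum_insert hk, Finset.sum_insert hk]
    rcases (hθ k).1.eq_or_lt with h0 | h0
    · rw [← h0, Pi.single_zero, zero_add, zero_add]
      exact ih
    rw [add_comm (Pi.single k (θ k) : Fin n → ℝ), ← ofAngles_mul hU]
    set y := ofAngles U (∑ k ∈ S, Pi.single k (θ k)) with hy
    set r := ofAngles U (Pi.single k (θ k)) with hr
    have hym : y ∈ Matrix.unitaryGroup (Fin n) ℂ := ofAngles_mem hU _
    have h1 := matAge_mul_reflection_le (mul_mem hx hym) hU k h0
    rw [← hr, mul_assoc] at h1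
    have h2 := Submodule.finrank_sup_add_finrank_inf_eq (fixedSpace x ⊓ fixedSpace y)
      (fixedSpace (x * y) ⊓ fixedSpace r)
    have h3 : Module.finrank ℂ
        ↥((fixedSpace x ⊓ fixedSpace y) ⊔ (fixedSpace (x * y) ⊓ fixedSpace r)) ≤
        Module.finrank ℂ (fixedSpace (x * y)) := by
      refine Submodule.finrank_mono (sup_le ?_ inf_le_left)
      rintro v ⟨hvx, hvy⟩
      rw [mem_fixedSpace, ← Matrix.mulVec_mulVec, mem_fixedSpace.1 hvy, mem_fixedSpace.1 hvx]
    have h4 : Module.finrank ℂ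
        ↥((fixedSpace x ⊓ fixedSpace y) ⊓ (fixedSpace (x * y) ⊓ fixedSpace r)) ≤
        Module.finrank ℂ ↥(fixedSpace x ⊓ fixedSpace (y * r)) := by
      refine Submodule.finrank_mono ?_
      rintro v ⟨⟨hvx, hvy⟩, -, hvr⟩
      refine ⟨hvx, mem_fixedSpace.2 ?_⟩
      rw [← Matrix.mulVec_mulVec, mem_fixedSpace.1 hvr, mem_fixedSpace.1 hvy]
    have h5 : (Module.finrank ℂ ↥(fixedSpace x ⊓ fixedSpace y) : ℝ) +
        Module.finrank ℂ ↥(fixedSpace (x * y) ⊓ fixedSpace r) ≤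
        Module.finrank ℂ (fixedSpace (x * y)) +
          Module.finrank ℂ ↥(fixedSpace x ⊓ fixedSpace (y * r)) := by
      exact_mod_cast (by omega)
    linarith

end

end

/-- Chen–Ruan inequality. Let `x, y` be unitary operators on an
`n`-dimensional complex inner product space. Then
`age(x) + age(y) − age(xy) + dim V^{x,y} − dim V^{xy} ≥ 0`. -/
theorem stmt7 (n : ℕ) (x y : Matrix (Fin n) (Fin n) ℂ)
    (hx : x ∈ Matrix.unitaryGroup (Fin n) ℂ)
    (hy : y ∈ Matrix.unitaryGroup (Fin n) ℂ) :
    0 ≤ matAge x + matAge y - matAge (x * y)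
        + (Module.finrank ℂ ↥(fixedSpace x ⊓ fixedSpace y) : ℝ)
        - (Module.finrank ℂ ↥(fixedSpace (x * y)) : ℝ) := by
  obtain ⟨U, hU, θ, hθ, rfl⟩ := exists_ofAngles_eq hy
  have h := matAge_mul_add_finrank_le hx hU hθ Finset.univ
  rw [Finset.univ_sum_single] at h
  rw [matAge_ofAngles hU hθ]
  linarith
end

section
/- Let V be a complex inner product space of dimension n > 1, and let x, y be unitary operators on V, where x is a complex reflection with eigenvalue-angle list [x] = (r, 0, …, 0) for some 0 < r < 1. Write [y] = (a₁, …, aₙ) and [xy] = (b₁, …, bₙ) for the eigenvalue-angle lists of y and xy. Then the following are equivalent: (i) the group ⟨x, y⟩ acts irreducibly on V; (ii) x and y have no common eigenvector; (iii) the multiset {a₁, …, aₙ, b₁, …, bₙ} consists of 2n pairwise distinct real numbers. -/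
open scoped Real

section Reflection

variable {E : Type*} [NormedAddCommGroup E] [InnerProductSpace ℂ E] [FiniteDimensional ℂ E]

open Module Module.End

/-- The orthogonal complement of an invariant subspace of a linear isometry is invariant. -/
lemma LinearIsometry.map_mem_orthogonal (T : E →ₗᵢ[ℂ] E) {W : Submodule ℂ E}
    (hW : ∀ w ∈ W, T w ∈ W) {v : E} (hv : v ∈ Wᗮ) : T v ∈ Wᗮ := by
  have hmap : W.map T.toLinearMap = W := by
    refine Submodule.eq_of_le_of_finrank_eq ?_
      (LinearEquiv.finrank_eq (Submodule.equivMapOfInjective T.toLinearMap T.injective W)).symm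
    rintro _ ⟨w, hw, rfl⟩
    exact hW w hw
  rw [Submodule.mem_orthogonal] at hv ⊢
  intro w hw
  rw [← hmap] at hw
  obtain ⟨w', hw', rfl⟩ := hw
  exact (T.inner_map_map w' v).trans (hv w' hw')

lemma LinearIsometry.isSemisimple (T : E →ₗᵢ[ℂ] E) : IsSemisimple T.toLinearMap :=
  isSemisimple_iff.2 fun p hp => ⟨pᗮ, fun _ hv => T.map_mem_orthogonal hp hv,
    p.isCompl_orthogonal⟩

/-- For a linear isometry, geometric and algebraic multiplicities of an eigenvalue agree. -/
lemma LinearIsometry.finrank_eigenspace (T : E →ₗᵢ[ℂ] E) (μ : ℂ) :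
    finrank ℂ (eigenspace T.toLinearMap μ) = T.toLinearMap.charpoly.rootMultiplicity μ := by
  rw [← LinearMap.finrank_maxGenEigenspace_eq,
    T.isSemisimple.isFinitelySemisimple.maxGenEigenspace_eq_eigenspace]

lemma Module.End.exists_eigenvector_mem (T : End ℂ E) {W : Submodule ℂ E}
    (hW : ∀ w ∈ W, T w ∈ W) (hW0 : W ≠ ⊥) : ∃ v ∈ W, v ≠ 0 ∧ ∃ ν : ℂ, T v = ν • v := by
  have : Nontrivial W := Submodule.nontrivial_iff_ne_bot.2 hW0
  obtain ⟨ν, hν⟩ := exists_eigenvalue (LinearMap.restrict T hW)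
  obtain ⟨v, hv⟩ := hν.exists_hasEigenvector
  exact ⟨v, v.2, fun h => hv.2 (Subtype.ext h), ν, congrArg Subtype.val hv.apply_eq_smul⟩

variable {X Y : E →ₗᵢ[ℂ] E}

lemma exists_smul_eq_map_sub (hX : finrank ℂ E ≤ finrank ℂ (eigenspace X.toLinearMap 1) + 1) :
    ∃ u : E, ∀ v, ∃ c : ℂ, c • u = X v - v := by
  have hker : eigenspace X.toLinearMap 1 = LinearMap.ker (X.toLinearMap - LinearMap.id) := by
    ext v
    simp [sub_eq_zero]
  have hrank := (X.toLinearMap - LinearMap.id).finrank_range_add_finrank_ker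
  rw [hker] at hX
  obtain ⟨u, hu⟩ := finrank_le_one_iff.1
    (show finrank ℂ (LinearMap.range (X.toLinearMap - LinearMap.id)) ≤ 1 by omega)
  refine ⟨u, fun v => ?_⟩
  obtain ⟨c, hc⟩ := hu ⟨_, LinearMap.mem_range_self (X.toLinearMap - LinearMap.id) v⟩
  exact ⟨c, congrArg Subtype.val hc⟩

/-- If `X` is a reflection and `X`, `Y` share a nontrivial invariant subspace, then some eigenvector
of `Y` is fixed by `X`. -/
lemma exists_fixed_eigenvector_of_invariant
    (hX : finrank ℂ E ≤ finrank ℂ (eigenspace X.toLinearMap 1) + 1) {W : Submodule ℂ E}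
    (hXW : ∀ w ∈ W, X w ∈ W) (hYW : ∀ w ∈ W, Y w ∈ W) (h0 : W ≠ ⊥) (h1 : W ≠ ⊤) :
    ∃ v : E, v ≠ 0 ∧ X v = v ∧ ∃ ν : ℂ, Y v = ν • v := by
  obtain ⟨u, hu⟩ := exists_smul_eq_map_sub hX
  by_cases huW : u ∈ W
  · obtain ⟨v, hvW, hv0, hν⟩ := exists_eigenvector_mem Y.toLinearMap
      (fun w hw => Y.map_mem_orthogonal hYW hw) (mt W.orthogonal_eq_bot_iff.1 h1)
    obtain ⟨c, hc⟩ := hu v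
    have hmem : X v - v ∈ W ⊓ Wᗮ :=
      ⟨hc ▸ W.smul_mem c huW, sub_mem (X.map_mem_orthogonal hXW hvW) hvW⟩
    rw [W.inf_orthogonal_eq_bot, Submodule.mem_bot, sub_eq_zero] at hmem
    exact ⟨v, hv0, hmem, hν⟩
  · obtain ⟨v, hvW, hv0, hν⟩ := exists_eigenvector_mem Y.toLinearMap hYW h0
    refine ⟨v, hv0, ?_, hν⟩
    obtain ⟨c, hc⟩ := hu v
    have hmem : c • u ∈ W := hc ▸ sub_mem (hXW v hvW) hvW
    obtain rfl : c = 0 := by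
      by_contra hc0
      exact huW ((W.smul_mem_iff hc0).1 hmem)
    rw [zero_smul] at hc
    exact sub_eq_zero.1 hc.symm

lemma exists_fixed_eigenvector_of_common_eigenvector (hn : 1 < finrank ℂ E)
    (hX : finrank ℂ E ≤ finrank ℂ (eigenspace X.toLinearMap 1) + 1)
    {v : E} (hv : v ≠ 0) {μ ν : ℂ} (hμ : X v = μ • v) (hν : Y v = ν • v) :
    ∃ v : E, v ≠ 0 ∧ X v = v ∧ ∃ ν : ℂ, Y v = ν • v := by
  have hinv {T : E →ₗᵢ[ℂ] E} {c : ℂ} (h : T v = c • v) : ∀ w ∈ ℂ ∙ v, T w ∈ ℂ ∙ v := by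
    intro w hw
    obtain ⟨d, rfl⟩ := Submodule.mem_span_singleton.1 hw
    rw [map_smul, h]
    exact Submodule.smul_mem _ _ (Submodule.smul_mem _ _ (Submodule.mem_span_singleton_self v))
  refine exists_fixed_eigenvector_of_invariant hX (hinv hμ) (hinv hν)
    (by simpa using hv) fun htop => ?_
  have := finrank_span_singleton (K := ℂ) hv
  rw [htop, finrank_top] at this
  omega

/-- An eigenspace of dimension at least two meets the fixed hyperplane of a reflection. -/
lemma exists_fixed_mem_eigenspace (T : End ℂ E)
    (hX : finrank ℂ E ≤ finrank ℂ (eigenspace X.toLinearMap 1) + 1) {μ : ℂ}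
    (hT : 2 ≤ finrank ℂ (eigenspace T μ)) : ∃ v : E, v ≠ 0 ∧ X v = v ∧ T v = μ • v := by
  have hsum := Submodule.finrank_sup_add_finrank_inf_eq (eigenspace X.toLinearMap 1)
    (eigenspace T μ)
  have hle := Submodule.finrank_le (eigenspace X.toLinearMap 1 ⊔ eigenspace T μ)
  have hne : eigenspace X.toLinearMap 1 ⊓ eigenspace T μ ≠ ⊥ := by
    intro h
    rw [h, finrank_bot] at hsum
    omega
  obtain ⟨v, ⟨hv1, hv2⟩, hv0⟩ := Submodule.exists_mem_ne_zero_of_ne_bot hne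
  exact ⟨v, hv0, by simpa using mem_eigenspace_iff.1 hv1, mem_eigenspace_iff.1 hv2⟩

omit [FiniteDimensional ℂ E] in
/-- For an eigenvector `v` with eigenvalue `μ`, the range of `T - μ` is orthogonal to `v`. -/
lemma LinearIsometry.inner_map_sub_smul (T : E →ₗᵢ[ℂ] E) {v : E} {μ : ℂ}
    (hv : T v = μ • v) (w : E) : inner ℂ v (T w - μ • w) = 0 := by
  rcases eq_or_ne v 0 with rfl | hv0
  · simp
  have hμ : ‖μ‖ = 1 := by
    have := T.norm_map v
    rw [hv, norm_smul] at this
    exact mul_right_cancel₀ (norm_ne_zero_iff.2 hv0) (this.trans (one_mul _).symm)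
  have h := T.inner_map_map v w
  rw [hv, inner_smul_left] at h
  have hμ' : μ * (starRingEnd ℂ) μ = 1 := by
    rw [Complex.mul_conj, Complex.normSq_eq_norm_sq, hμ]
    simp
  rw [inner_sub_right, inner_smul_right, ← h, ← mul_assoc, hμ', one_mul, sub_self]

lemma exists_fixed_eigenvector_of_shared_eigenvalue
    (hX : finrank ℂ E ≤ finrank ℂ (eigenspace X.toLinearMap 1) + 1) {v w : E} {μ : ℂ}
    (hv0 : v ≠ 0) (hv : Y v = μ • v) (hw0 : w ≠ 0) (hw : X (Y w) = μ • w) :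
    ∃ v : E, v ≠ 0 ∧ X v = v ∧ ∃ ν : ℂ, Y v = ν • v := by
  obtain ⟨u, hu⟩ := exists_smul_eq_map_sub hX
  obtain ⟨c, hc⟩ := hu (Y w)
  have horth := Y.inner_map_sub_smul hv w
  rw [← hw, ← neg_sub, ← hc, inner_neg_right, neg_eq_zero, inner_smul_right, mul_eq_zero] at horth
  rcases horth with rfl | horth
  · have hfix : X (Y w) = Y w := by
      rw [zero_smul] at hc
      exact sub_eq_zero.1 hc.symm
    have hYw : Y w = μ • w := hfix.symm.trans hw
    refine ⟨Y w, fun h => hw0 (Y.injective (h.trans Y.map_zero.symm)), hfix, μ, ?_⟩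
    conv_lhs => rw [hYw, map_smul]
  · obtain ⟨d, hd⟩ := hu v
    have hXv : X v = v + d • u := by rw [hd]; abel
    have hsq := norm_add_sq_eq_norm_sq_add_norm_sq_of_inner_eq_zero (𝕜 := ℂ) v (d • u)
      (by rw [inner_smul_right, horth, mul_zero])
    rw [← hXv, X.norm_map] at hsq
    have hdu : d • u = 0 := by
      rw [← norm_eq_zero, ← mul_self_eq_zero]
      linarith
    exact ⟨v, hv0, by rw [hXv, hdu, add_zero], μ, hv⟩

open Polynomial in
lemma two_le_finrank_eigenspace_of_eq {ι : Type*} [Fintype ι] (T : E →ₗᵢ[ℂ] E) {α : ι → ℂ}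
    (hα : T.toLinearMap.charpoly = ∏ j, (Polynomial.X - C (α j))) {i j : ι} (hij : i ≠ j)
    (h : α i = α j) : 2 ≤ finrank ℂ (eigenspace T.toLinearMap (α i)) := by
  classical
  rw [T.finrank_eigenspace, le_rootMultiplicity_iff T.toLinearMap.charpoly_monic.ne_zero, hα]
  have hdvd := Finset.prod_dvd_prod_of_subset {i, j} Finset.univ (fun j => Polynomial.X - C (α j))
    (Finset.subset_univ _)
  rwa [Finset.prod_pair hij, ← h, ← sq] at hdvd

open Polynomial in
lemma hasEigenvalue_iff_exists_eq {ι : Type*} [Fintype ι] (T : End ℂ E) {α : ι → ℂ}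
    (hα : T.charpoly = ∏ j, (Polynomial.X - C (α j))) {μ : ℂ} : T.HasEigenvalue μ ↔ ∃ i, α i = μ := by
  rw [hasEigenvalue_iff_isRoot_charpoly, hα, IsRoot.def, eval_prod, Finset.prod_eq_zero_iff]
  simp [sub_eq_zero, eq_comm]

open Polynomial in
/-- A reflection `X` has a fixed vector that is an eigenvector of `Y` exactly when the eigenvalues
of `Y` and `XY`, taken together, are not pairwise distinct. -/
lemma exists_fixed_eigenvector_iff {ι κ : Type*} [Fintype ι] [Fintype κ]
    (hX : finrank ℂ E ≤ finrank ℂ (eigenspace X.toLinearMap 1) + 1) {α : ι → ℂ} {β : κ → ℂ}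
    (hα : Y.toLinearMap.charpoly = ∏ j, (Polynomial.X - C (α j)))
    (hβ : (X.comp Y).toLinearMap.charpoly = ∏ j, (Polynomial.X - C (β j))) :
    (∃ v : E, v ≠ 0 ∧ X v = v ∧ ∃ ν : ℂ, Y v = ν • v) ↔
      ¬ Function.Injective (Sum.elim α β) := by
  constructor
  · rintro ⟨v, hv0, hXv, ν, hν⟩ hinj
    have hXY : X (Y v) = ν • v := by rw [hν, map_smul, hXv]
    obtain ⟨i, hi⟩ := (hasEigenvalue_iff_exists_eq _ hα).1
      (hasEigenvalue_of_hasEigenvector ⟨mem_eigenspace_iff.2 hν, hv0⟩)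
    obtain ⟨j, hj⟩ := (hasEigenvalue_iff_exists_eq _ hβ).1
      (hasEigenvalue_of_hasEigenvector ⟨mem_eigenspace_iff.2 hXY, hv0⟩)
    exact Sum.inl_ne_inr (hinj (hi.trans hj.symm : Sum.elim α β (.inl i) = Sum.elim α β (.inr j)))
  · have hshared {i : ι} {j : κ} (h : α i = β j) :
        ∃ v : E, v ≠ 0 ∧ X v = v ∧ ∃ ν : ℂ, Y v = ν • v := by
      obtain ⟨v, hv⟩ := ((hasEigenvalue_iff_exists_eq _ hα).2 ⟨i, h⟩).exists_hasEigenvector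
      obtain ⟨w, hw⟩ := ((hasEigenvalue_iff_exists_eq _ hβ).2 ⟨j, rfl⟩).exists_hasEigenvector
      exact exists_fixed_eigenvector_of_shared_eigenvalue hX hv.2 hv.apply_eq_smul hw.2
        hw.apply_eq_smul
    intro hinj
    simp only [Function.Injective, not_forall] at hinj
    obtain ⟨i | i, j | j, hij, hne⟩ := hinj
    · obtain ⟨v, hv0, hXv, hv⟩ := exists_fixed_mem_eigenspace _ hX
        (two_le_finrank_eigenspace_of_eq Y hα (fun h => hne (congrArg _ h)) hij)
      exact ⟨v, hv0, hXv, _, hv⟩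
    · exact hshared hij
    · exact hshared hij.symm
    · obtain ⟨v, hv0, hXv, hv⟩ := exists_fixed_mem_eigenspace _ hX
        (two_le_finrank_eigenspace_of_eq (X.comp Y) hβ (fun h => hne (congrArg _ h)) hij)
      refine ⟨v, hv0, hXv, β i, X.injective ?_⟩
      rw [map_smul, hXv]
      exact hv

open Polynomial in
lemma finrank_le_finrank_eigenspace_one_add_one {ζ : ℂ}
    (hX : X.toLinearMap.charpoly =
      (Polynomial.X - C ζ) * (Polynomial.X - 1) ^ (finrank ℂ E - 1)) :
    finrank ℂ E ≤ finrank ℂ (eigenspace X.toLinearMap 1) + 1 := by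
  have hle : finrank ℂ E - 1 ≤ X.toLinearMap.charpoly.rootMultiplicity 1 := by
    rw [le_rootMultiplicity_iff X.toLinearMap.charpoly_monic.ne_zero, hX, map_one]
    exact dvd_mul_left _ _
  rw [X.finrank_eigenspace]
  omega

end Reflection

lemma Complex.exp_two_pi_mul_I_mul_injOn :
    Set.InjOn (fun t : ℝ => Complex.exp (2 * π * Complex.I * t)) (Set.Ico 0 1) := by
  intro s hs t ht h
  obtain ⟨m, hm⟩ := Complex.exp_eq_exp_iff_exists_int.1 h
  have hst : s = t + m := by
    have : (s : ℂ) = t + m := mul_left_cancel₀ Complex.two_pi_I_ne_zero (by rw [hm]; ring)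
    exact_mod_cast this
  obtain rfl : m = 0 := by
    have h1 : (-1 : ℝ) < m := by linarith [hs.1, ht.2]
    have h2 : (m : ℝ) < 1 := by linarith [hs.2, ht.1]
    norm_cast at h1 h2
    omega
  simpa using hst

/-- The linear isometry of Euclidean space given by a unitary matrix. -/
noncomputable def Matrix.unitaryIsometry {ι : Type*} [Fintype ι] [DecidableEq ι]
    (x : Matrix ι ι ℂ) (hx : x ∈ Matrix.unitaryGroup ι ℂ) :
    EuclideanSpace ℂ ι →ₗᵢ[ℂ] EuclideanSpace ℂ ι :=
  x.toEuclideanLin.isometryOfInner fun v w => by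
    rw [← LinearMap.adjoint_inner_right, ← Matrix.toEuclideanLin_conjTranspose_eq_adjoint,
      Matrix.toLpLin_apply, Matrix.toLpLin_apply, Matrix.mulVec_mulVec,
      ← Matrix.star_eq_conjTranspose, Matrix.mem_unitaryGroup_iff'.1 hx, Matrix.one_mulVec]

section UnitaryIsometry

variable {ι : Type*} [Fintype ι] [DecidableEq ι]

lemma Matrix.unitaryIsometry_apply {x : Matrix ι ι ℂ} (hx : x ∈ Matrix.unitaryGroup ι ℂ)
    (v : EuclideanSpace ℂ ι) : x.unitaryIsometry hx v = WithLp.toLp 2 (x.mulVec v.ofLp) := rfl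

lemma Matrix.charpoly_unitaryIsometry {x : Matrix ι ι ℂ} (hx : x ∈ Matrix.unitaryGroup ι ℂ) :
    (x.unitaryIsometry hx).toLinearMap.charpoly = x.charpoly := by
  change (Matrix.toLpLin 2 2 x).charpoly = _
  rw [Matrix.toLpLin_eq_toLin]
  exact Matrix.charpoly_toLin x _

lemma Matrix.unitaryIsometry_comp {x y : Matrix ι ι ℂ} (hx : x ∈ Matrix.unitaryGroup ι ℂ)
    (hy : y ∈ Matrix.unitaryGroup ι ℂ) :
    (x.unitaryIsometry hx).comp (y.unitaryIsometry hy) =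
      (x * y).unitaryIsometry (mul_mem hx hy) := by
  ext1 v
  simp [Matrix.unitaryIsometry_apply, Matrix.mulVec_mulVec]

end UnitaryIsometry

/-- Let `x, y` be unitary operators on `ℂⁿ`, `n > 1`, with `x` a complex
reflection with eigenvalue-angle list `[x] = (r, 0, …, 0)`, `0 < r < 1` (i.e. `x` has the
eigenvalue `e^{2πi r}` with multiplicity one and the eigenvalue `1` with multiplicity
`n − 1`). Let `[y] = (a₁, …, aₙ)` and `[xy] = (b₁, …, bₙ)` be the (weakly increasing)
eigenvalue-angle lists of `y` and `xy`. Then the following are equivalent: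
(i) `⟨x, y⟩` acts irreducibly on `ℂⁿ`;
(ii) `x` and `y` have no common eigenvector;
(iii) the `2n` numbers `a₁, …, aₙ, b₁, …, bₙ` are pairwise distinct. -/
theorem stmt9 (n : ℕ) (hn : 1 < n) (x y : Matrix (Fin n) (Fin n) ℂ)
    (hx : x ∈ Matrix.unitaryGroup (Fin n) ℂ)
    (hy : y ∈ Matrix.unitaryGroup (Fin n) ℂ)
    (r : ℝ) (hr0 : 0 < r) (hr1 : r < 1)
    (hxev : x.charpoly =
      (Polynomial.X - Polynomial.C (Complex.exp (2 * π * Complex.I * r))) *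
        (Polynomial.X - 1) ^ (n - 1))
    (a b : Fin n → ℝ) (ha : Monotone a) (hb : Monotone b)
    (ha0 : ∀ j, 0 ≤ a j) (ha1 : ∀ j, a j < 1)
    (hb0 : ∀ j, 0 ≤ b j) (hb1 : ∀ j, b j < 1)
    (hyev : y.charpoly =
      ∏ j : Fin n, (Polynomial.X -
        Polynomial.C (Complex.exp (2 * π * Complex.I * (a j)))))
    (hxyev : (x * y).charpoly =
      ∏ j : Fin n, (Polynomial.X -
        Polynomial.C (Complex.exp (2 * π * Complex.I * (b j))))) :
    ((∀ W : Submodule ℂ (Fin n → ℂ),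
        (∀ w ∈ W, x.mulVec w ∈ W) → (∀ w ∈ W, y.mulVec w ∈ W) → W = ⊥ ∨ W = ⊤) ↔
      ¬ ∃ v : Fin n → ℂ, v ≠ 0 ∧ (∃ μ : ℂ, x.mulVec v = μ • v) ∧
        (∃ ν : ℂ, y.mulVec v = ν • v)) ∧
    ((¬ ∃ v : Fin n → ℂ, v ≠ 0 ∧ (∃ μ : ℂ, x.mulVec v = μ • v) ∧
        (∃ ν : ℂ, y.mulVec v = ν • v)) ↔
      Function.Injective (Sum.elim a b : Fin n ⊕ Fin n → ℝ)) := by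
  set X := x.unitaryIsometry hx
  set Y := y.unitaryIsometry hy
  have hfin : Module.finrank ℂ (EuclideanSpace ℂ (Fin n)) = n := finrank_euclideanSpace_fin
  have hX := finrank_le_finrank_eigenspace_one_add_one (X := X)
    (by rw [Matrix.charpoly_unitaryIsometry, hfin, hxev])
  have hfixed := exists_fixed_eigenvector_iff (Y := Y) hX
    ((Matrix.charpoly_unitaryIsometry hy).trans hyev)
    (by rw [Matrix.unitaryIsometry_comp hx hy, Matrix.charpoly_unitaryIsometry, hxyev])
  have hcommon : (∃ v : Fin n → ℂ, v ≠ 0 ∧ (∃ μ : ℂ, x.mulVec v = μ • v) ∧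
      (∃ ν : ℂ, y.mulVec v = ν • v)) ↔ ∃ v, v ≠ 0 ∧ X v = v ∧ ∃ ν : ℂ, Y v = ν • v := by
    constructor
    · rintro ⟨v, hv0, ⟨μ, hμ⟩, ν, hν⟩
      exact exists_fixed_eigenvector_of_common_eigenvector (v := WithLp.toLp 2 v) (by rwa [hfin])
        hX (by simpa using hv0) (congrArg (WithLp.toLp 2) hμ) (congrArg (WithLp.toLp 2) hν)
    · rintro ⟨v, hv0, hXv, ν, hν⟩
      exact ⟨v.ofLp, by simpa using hv0, ⟨1, (congrArg WithLp.ofLp hXv).trans (one_smul ℂ _).symm⟩, ν,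
        congrArg WithLp.ofLp hν⟩
  refine ⟨⟨?_, ?_⟩, ?_⟩
  · rintro hirr ⟨v, hv0, ⟨μ, hμ⟩, ν, hν⟩
    have hinv {z : Matrix (Fin n) (Fin n) ℂ} {c : ℂ} (h : z.mulVec v = c • v) :
        ∀ w ∈ Submodule.span ℂ {v}, z.mulVec w ∈ Submodule.span ℂ {v} := by
      intro w hw
      obtain ⟨d, rfl⟩ := Submodule.mem_span_singleton.1 hw
      rw [Matrix.mulVec_smul, h]
      exact Submodule.smul_mem _ _ (Submodule.smul_mem _ _ (Submodule.mem_span_singleton_self v))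
    rcases hirr _ (hinv hμ) (hinv hν) with h | h
    · exact hv0 (Submodule.span_singleton_eq_bot.1 h)
    · have hspan := finrank_span_singleton (K := ℂ) hv0
      rw [h, finrank_top, Module.finrank_fin_fun] at hspan
      omega
  · intro hno W hxW hyW
    by_contra! hW
    let e := WithLp.linearEquiv 2 ℂ (Fin n → ℂ)
    refine hno (hcommon.2 (exists_fixed_eigenvector_of_invariant (W := W.comap e.toLinearMap) hX
      (fun w hw => hxW _ hw) (fun w hw => hyW _ hw) (fun h => hW.1 ?_) fun h => hW.2 ?_))
    · rw [eq_bot_iff]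
      intro w hw
      have : WithLp.toLp 2 w ∈ W.comap e.toLinearMap := hw
      rw [h] at this
      simpa using this
    · rw [eq_top_iff]
      intro w _
      have : WithLp.toLp 2 w ∈ W.comap e.toLinearMap := h ▸ Submodule.mem_top
      exact this
  · rw [hcommon, hfixed, not_not]
    have hIco : ∀ s, Sum.elim a b s ∈ Set.Ico (0 : ℝ) 1 := by
      rintro (j | j)
      exacts [⟨ha0 j, ha1 j⟩, ⟨hb0 j, hb1 j⟩]
    have hcomp : Sum.elim (fun j => Complex.exp (2 * π * Complex.I * (a j)))
        (fun j => Complex.exp (2 * π * Complex.I * (b j))) =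
        (fun t : ℝ => Complex.exp (2 * π * Complex.I * t)) ∘ Sum.elim a b := by
      ext (j | j) <;> rfl
    rw [hcomp]
    exact ⟨Function.Injective.of_comp, fun h s t hst =>
      h (Complex.exp_two_pi_mul_I_mul_injOn (hIco s) (hIco t) hst)⟩
end

section
/- Let V be a complex inner product space of dimension n, and let x, y be unitary operators on V, where x is a complex reflection with eigenvalue-angle list [x] = (r, 0, …, 0), 0 < r < 1. Write [y] = (a₁, …, aₙ) and [xy] = (b₁, …, bₙ). Assume a_j < a_{j+1} and b_j < b_{j+1} for 1 ≤ j < n, and a_j ≠ b_k for all j, k. Then either a₁ < b₁ < a₂ < b₂ < … < aₙ < bₙ, or b₁ < a₁ < b₂ < a₂ < … < bₙ < aₙ. -/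
open scoped Real
open Matrix

open scoped ComplexOrder in
theorem Matrix.exists_unit_of_mulVec_eq {ι : Type*} [Fintype ι] {y : Matrix ι ι ℂ} {μ : ℂ}
    {v : ι → ℂ} (hv0 : v ≠ 0) (hv : y *ᵥ v = μ • v) :
    ∃ w : ι → ℂ, star w ⬝ᵥ w = 1 ∧ y *ᵥ w = μ • w := by
  have hpos : 0 < star v ⬝ᵥ v := dotProduct_star_self_pos_iff.2 hv0
  obtain ⟨s, hs⟩ : ∃ s : ℝ, (s : ℂ) = star v ⬝ᵥ v := ⟨_, (Complex.eq_re_of_ofReal_le hpos.le).symm⟩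
  have hs0 : 0 < s := by rw [← hs] at hpos; exact_mod_cast hpos
  refine ⟨((√s)⁻¹ : ℂ) • v, ?_, ?_⟩
  · have h : ((√s : ℝ) : ℂ) * (√s : ℝ) = s := by
      rw [← Complex.ofReal_mul, Real.mul_self_sqrt hs0.le]
    have h0 : ((√s : ℝ) : ℂ) ≠ 0 := by
      exact_mod_cast (Real.sqrt_pos.2 hs0).ne'
    rw [star_smul, smul_dotProduct, dotProduct_smul, ← hs, ← h]
    simp only [smul_eq_mul, star_inv₀, RCLike.star_def, Complex.conj_ofReal]
    field_simp
  · rw [mulVec_smul, hv, smul_comm]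

open scoped ComplexOrder in
theorem Matrix.eq_one_of_mem_unitaryGroup_of_trace_eq {ι : Type*} [Fintype ι] [DecidableEq ι]
    {u : Matrix ι ι ℂ} (hu : u ∈ unitaryGroup ι ℂ) (htr : u.trace = Fintype.card ι) : u = 1 := by
  rw [← sub_eq_zero, ← trace_conjTranspose_mul_self_eq_zero_iff]
  have h : uᴴ * u = 1 := mem_unitaryGroup_iff'.1 hu
  simp [sub_mul, mul_sub, h, htr, trace_conjTranspose]

theorem Matrix.one_add_smul_vecMulVec_star_mul {ι : Type*} [Fintype ι] [DecidableEq ι]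
    {v : ι → ℂ} (hv : star v ⬝ᵥ v = 1) (z w : ℂ) (hzw : z * w = 1):
    (1 + (z - 1) • vecMulVec v (star v)) * (1 + (w - 1) • vecMulVec v (star v)) = 1 := by
  have h : vecMulVec v (star v) * vecMulVec v (star v) = vecMulVec v (star v) := by
    rw [vecMulVec_mul_vecMulVec, hv, one_smul]
  simp only [add_mul, mul_add, one_mul, mul_one, smul_mul_assoc, mul_smul_comm, h]
  match_scalars
  · ring
  · linear_combination hzw

theorem Matrix.exists_eq_one_add_smul_vecMulVec_star {n : ℕ} (hn : 0 < n)
    {x : Matrix (Fin n) (Fin n) ℂ} (hx : x ∈ unitaryGroup (Fin n) ℂ) {ζ : ℂ}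
    (hζ : star ζ * ζ = 1)
    (hchar : x.charpoly = (Polynomial.X - Polynomial.C ζ) * (Polynomial.X - 1) ^ (n - 1)) :
    ∃ v : Fin n → ℂ, star v ⬝ᵥ v = 1 ∧ x = 1 + (ζ - 1) • vecMulVec v (star v) := by
  have hroot : (scalar (Fin n) ζ - x).det = 0 := by
    rw [← eval_charpoly, hchar]
    simp
  obtain ⟨v₀, hv0, hv⟩ := exists_mulVec_eq_zero_iff.2 hroot
  obtain ⟨v, hv1, hxv⟩ := exists_unit_of_mulVec_eq hv0 (show x *ᵥ v₀ = ζ • v₀ by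
    rw [sub_mulVec, sub_eq_zero] at hv
    simpa using hv.symm)
  refine ⟨v, hv1, ?_⟩
  have htr : x.trace = ζ + (n - 1) := by
    have hne : (Polynomial.X - Polynomial.C ζ) * (Polynomial.X - Polynomial.C 1) ^ (n - 1) ≠ 0 :=
      ((Polynomial.monic_X_sub_C _).mul ((Polynomial.monic_X_sub_C _).pow _)).ne_zero
    rw [trace_eq_sum_roots_charpoly, hchar, ← Polynomial.C_1, Polynomial.roots_mul hne,
      Polynomial.roots_pow, Polynomial.roots_X_sub_C, Polynomial.roots_X_sub_C]
    simp [Multiset.sum_nsmul, Nat.cast_sub (Nat.succ_le_of_lt hn)]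
  set R := 1 + (star ζ - 1) • vecMulVec v (star v) with hR
  have hR1 := one_add_smul_vecMulVec_star_mul hv1 ζ (star ζ) (by rw [mul_comm, hζ])
  have hstar : star R = 1 + (ζ - 1) • vecMulVec v (star v) := by
    simp [hR, star_eq_conjTranspose, conjTranspose_vecMulVec]
  have hRu : R ∈ unitaryGroup (Fin n) ℂ := by
    rw [mem_unitaryGroup_iff', hstar]; exact hR1
  have hone : x * R = 1 := by
    refine eq_one_of_mem_unitaryGroup_of_trace_eq (mul_mem hx hRu) ?_
    rw [hR, mul_add, mul_one, mul_smul_comm, mul_vecMulVec, hxv, trace_add, trace_smul,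
      trace_vecMulVec, htr, smul_dotProduct, dotProduct_comm, hv1, Fintype.card_fin, smul_eq_mul,
      smul_eq_mul]
    linear_combination hζ
  calc x = x * (R * star R) := by rw [mem_unitaryGroup_iff.1 hRu, mul_one]
    _ = _ := by rw [← mul_assoc, hone, one_mul, hstar]

theorem Matrix.det_diagonal_add_vecMulVec_of_eq_zero {ι R : Type*} [Fintype ι] [DecidableEq ι]
    [CommRing R] (d u w : ι → R) (j : ι) (hj : d j = 0) :
    (diagonal d + vecMulVec u w).det = u j * w j * ∏ k ∈ Finset.univ.erase j, d k := by
  have hrow : diagonal d + vecMulVec u w =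
      updateRow (diagonal d + vecMulVec u w) j (u j • w) := by
    ext i k
    by_cases hi : i = j
    · subst hi
      by_cases hk : i = k
      · subst hk; simp [vecMulVec_apply, hj]
      · simp [vecMulVec_apply, diagonal_apply_ne _ hk]
    · simp [updateRow_ne hi]
  have hdet : (updateRow (diagonal d + vecMulVec u w) j w).det =
      (updateRow (diagonal d) j w).det := by
    refine det_eq_of_forall_row_eq_smul_add_const (Function.update u j 0) j (by simp) fun i k ↦ ?_
    by_cases hi : i = j
    · subst hi; simp
    · simp [hi, vecMulVec_apply]
  rw [hrow, det_updateRow_smul, hdet, ← cramer_transpose_apply, cramer_eq_adjugate_mulVec,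
    diagonal_transpose, adjugate_diagonal, mulVec_diagonal]
  ring

theorem Matrix.exists_unitary_diagonalization {ι : Type*} [Fintype ι] [DecidableEq ι]
    {y : Matrix ι ι ℂ} (hy : y ∈ unitaryGroup ι ℂ) {α : ι → ℂ} (hα : Function.Injective α)
    (hchar : y.charpoly = ∏ j, (Polynomial.X - Polynomial.C (α j))) :
    ∃ E ∈ unitaryGroup ι ℂ, y = E * diagonal α * star E := by
  have hexists : ∀ j, ∃ v : ι → ℂ, star v ⬝ᵥ v = 1 ∧ y *ᵥ v = α j • v := by
    intro j
    have hroot : (scalar ι (α j) - y).det = 0 := by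
      rw [← eval_charpoly, hchar, Polynomial.eval_prod]
      exact Finset.prod_eq_zero (Finset.mem_univ j) (by simp)
    obtain ⟨v, hv0, hv⟩ := exists_mulVec_eq_zero_iff.2 hroot
    exact exists_unit_of_mulVec_eq hv0 (by
      rw [sub_mulVec, sub_eq_zero] at hv
      simpa using hv.symm)
  choose e he hye using hexists
  have hinner : ∀ i j, star (e i) ⬝ᵥ e j = star (α i) * α j * (star (e i) ⬝ᵥ e j) := by
    intro i j
    calc star (e i) ⬝ᵥ e j = star (y *ᵥ e i) ⬝ᵥ (y *ᵥ e j) := by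
          rw [star_mulVec, ← dotProduct_mulVec, mulVec_mulVec, ← star_eq_conjTranspose,
            (mem_unitaryGroup_iff'.1 hy), one_mulVec]
      _ = _ := by
          rw [hye, hye, star_smul, smul_dotProduct, dotProduct_smul, smul_eq_mul, smul_eq_mul,
            mul_assoc]
  have hnorm : ∀ i, star (α i) * α i = 1 := fun i ↦ by
    have := hinner i i
    rw [he, mul_one] at this
    exact this.symm
  have horth : ∀ i j, star (e i) ⬝ᵥ e j = (1 : Matrix ι ι ℂ) i j := by
    intro i j
    by_cases hij : i = j
    · subst hij; simp [he]
    · rw [one_apply_ne hij]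
      by_contra h
      have h1 : star (α i) * α j = 1 := by
        have := hinner i j
        exact mul_right_cancel₀ h (by rw [one_mul]; exact this.symm)
      have h2 : star (α i) ≠ 0 := left_ne_zero_of_mul_eq_one h1
      exact hij (hα (mul_left_cancel₀ h2 ((hnorm i).trans h1.symm)))
  let E : Matrix ι ι ℂ := of fun i j ↦ e j i
  have hE : star E * E = 1 := by
    ext i j
    rw [← horth i j, star_eq_conjTranspose, mul_apply]
    rfl
  have hE' : E * star E = 1 := mul_eq_one_comm.1 hE
  refine ⟨E, mem_unitaryGroup_iff.2 hE', ?_⟩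
  have hyE : y * E = E * diagonal α := by
    ext i j
    rw [mul_diagonal]
    exact (congrFun (hye j) i).trans (mul_comm _ _)
  rw [← hyE, Matrix.mul_assoc, hE', Matrix.mul_one]

theorem Matrix.eval_charpoly_one_add_smul_vecMulVec_star_mul {ι : Type*} [Fintype ι]
    [DecidableEq ι] {y : Matrix ι ι ℂ} (hy : y ∈ unitaryGroup ι ℂ) {α : ι → ℂ}
    (hα : Function.Injective α)
    (hchar : y.charpoly = ∏ j, (Polynomial.X - Polynomial.C (α j))) (c : ℂ) (v : ι → ℂ) :
    ∃ ρ : ι → ℝ, (∀ j, 0 ≤ ρ j) ∧ ∀ j,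
      ((1 + c • vecMulVec v (star v)) * y).charpoly.eval (α j) =
        -c * ρ j * (α j * ∏ k ∈ Finset.univ.erase j, (α j - α k)) := by
  obtain ⟨E, hE, hyE⟩ := exists_unitary_diagonalization hy hα hchar
  have hE1 : star E * E = 1 := mem_unitaryGroup_iff'.1 hE
  set w := star E *ᵥ v with hw
  refine ⟨fun j ↦ Complex.normSq (w j), fun j ↦ Complex.normSq_nonneg _, fun j ↦ ?_⟩
  have hyE' : y * E = E * diagonal α := by
    rw [hyE, Matrix.mul_assoc, hE1, Matrix.mul_one]
  have hvE : star v ᵥ* E = star w := by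
    rw [hw, star_mulVec, ← star_eq_conjTranspose, star_star]
  have hconj : star E * (scalar ι (α j) - (1 + c • vecMulVec v (star v)) * y) * E =
      diagonal (fun k ↦ α j - α k) + vecMulVec (-c • w) (fun k ↦ star w k * α k) := by
    have h1 : star E * scalar ι (α j) * E = scalar ι (α j) := by
      rw [← (scalar_commute (α j) (fun _ ↦ mul_comm _ _) (star E)).eq, Matrix.mul_assoc, hE1,
        Matrix.mul_one]
    have h2 : star E * y * E = diagonal α := by
      rw [Matrix.mul_assoc, hyE', ← Matrix.mul_assoc, hE1, Matrix.one_mul]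
    have h3 : star E * (vecMulVec v (star v) * y) * E =
        vecMulVec w (fun k ↦ star w k * α k) := by
      rw [Matrix.mul_assoc, Matrix.mul_assoc, hyE', vecMulVec_mul, mul_vecMulVec, ← hw,
        ← vecMul_vecMul, hvE]
      congr 1
      ext k
      exact vecMul_diagonal _ _ _
    rw [add_mul, one_mul, mul_sub, mul_add, sub_mul, add_mul, h1, h2, smul_mul_assoc,
      mul_smul_comm, smul_mul_assoc, h3, smul_vecMulVec, neg_smul, ← sub_sub, ← sub_eq_add_neg,
      scalar_apply, diagonal_sub]
  have hdet (M : Matrix ι ι ℂ) : M.det = (star E * M * E).det := by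
    rw [det_mul_right_comm, hE1, one_mul]
  rw [eval_charpoly, hdet, hconj, det_diagonal_add_vecMulVec_of_eq_zero _ _ _ j (sub_self _),
    ← Complex.mul_conj]
  simp only [Pi.smul_apply, smul_eq_mul, Pi.star_apply, RCLike.star_def]
  ring

theorem Complex.exp_sub_exp_eq_sin (s t : ℝ) :
    Complex.exp (2 * π * Complex.I * s) - Complex.exp (2 * π * Complex.I * t) =
      Complex.exp (π * Complex.I * s) * Complex.exp (π * Complex.I * t) *
        (2 * Complex.I * Real.sin (π * (s - t))) := by
  have hs : Complex.exp (2 * π * Complex.I * s) =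
      Complex.exp (π * Complex.I * s) * Complex.exp (π * Complex.I * s) := by
    rw [← Complex.exp_add]; ring_nf
  have ht : Complex.exp (2 * π * Complex.I * t) =
      Complex.exp (π * Complex.I * t) * Complex.exp (π * Complex.I * t) := by
    rw [← Complex.exp_add]; ring_nf
  have h1 : Complex.exp (-(π * (s - t) : ℂ) * Complex.I) =
      Complex.exp (π * Complex.I * t) * (Complex.exp (π * Complex.I * s))⁻¹ := by
    rw [← Complex.exp_neg, ← Complex.exp_add]; ring_nf
  have h2 : Complex.exp ((π * (s - t) : ℂ) * Complex.I) =
      Complex.exp (π * Complex.I * s) * (Complex.exp (π * Complex.I * t))⁻¹ := by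
    rw [← Complex.exp_neg, ← Complex.exp_add]; ring_nf
  have hs0 := Complex.exp_ne_zero (π * Complex.I * s)
  have ht0 := Complex.exp_ne_zero (π * Complex.I * t)
  push_cast
  rw [hs, ht, Complex.sin, h1, h2]
  field_simp
  linear_combination (Complex.exp (π * Complex.I * s) ^ 2 - Complex.exp (π * Complex.I * t) ^ 2) *
    Complex.I_sq

theorem Real.sin_pi_mul_pos {u : ℝ} (h0 : 0 < u) (h1 : u < 1) : 0 < Real.sin (π * u) :=
  Real.sin_pos_of_pos_of_lt_pi (by positivity) (by nlinarith [Real.pi_pos])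

theorem Real.sin_pi_mul_neg {u : ℝ} (h0 : u < 0) (h1 : -1 < u) : Real.sin (π * u) < 0 :=
  Real.sin_neg_of_neg_of_neg_pi_lt (by nlinarith [Real.pi_pos]) (by nlinarith [Real.pi_pos])

theorem Real.sin_pi_mul_ne_zero {u : ℝ} (h0 : u ≠ 0) (h1 : |u| < 1) : Real.sin (π * u) ≠ 0 := by
  rcases h0.lt_or_gt with h | h
  · exact (sin_pi_mul_neg h (abs_lt.1 h1).1).ne
  · exact (sin_pi_mul_pos h (abs_lt.1 h1).2).ne'

theorem Real.sin_pi_mul_mul_sin_pi_mul_pos {u w : ℝ} (hu : |u| < 1) (hw : |w| < 1)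
    (huw : 0 < u * w) : 0 < Real.sin (π * u) * Real.sin (π * w) := by
  rw [abs_lt] at hu hw
  rcases mul_pos_iff.1 huw with ⟨h1, h2⟩ | ⟨h1, h2⟩
  · exact mul_pos (sin_pi_mul_pos h1 hu.2) (sin_pi_mul_pos h2 hw.2)
  · exact mul_pos_of_neg_of_neg (sin_pi_mul_neg h1 hu.1) (sin_pi_mul_neg h2 hw.1)

theorem exists_sin_prod_eq_of_charpoly {n : ℕ} {y : Matrix (Fin n) (Fin n) ℂ}
    (hy : y ∈ unitaryGroup (Fin n) ℂ) {a b : Fin n → ℝ} (ha : StrictMono a)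
    (ha0 : ∀ j, 0 ≤ a j) (ha1 : ∀ j, a j < 1)
    (hchar : y.charpoly =
      ∏ j : Fin n, (Polynomial.X - Polynomial.C (Complex.exp (2 * π * Complex.I * (a j)))))
    {c : ℂ} {v : Fin n → ℂ}
    (hchar' : ((1 + c • vecMulVec v (star v)) * y).charpoly =
      ∏ j : Fin n, (Polynomial.X - Polynomial.C (Complex.exp (2 * π * Complex.I * (b j))))) :
    ∃ (d : ℂ) (ρ : Fin n → ℝ), (∀ j, 0 ≤ ρ j) ∧ ∀ j,
      ((∏ k, Real.sin (π * (a j - b k)) : ℝ) : ℂ) =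
        d * ρ j * (∏ k ∈ Finset.univ.erase j, Real.sin (π * (a j - a k)) : ℝ) := by
  have hα : Function.Injective fun j ↦ Complex.exp (2 * π * Complex.I * (a j)) := by
    intro i j hij
    by_contra hne
    have h := Complex.exp_sub_exp_eq_sin (a i) (a j)
    rw [show Complex.exp (2 * π * Complex.I * (a i)) = Complex.exp (2 * π * Complex.I * (a j))
      from hij, sub_self] at h
    have hsin : Real.sin (π * (a i - a j)) ≠ 0 :=
      Real.sin_pi_mul_ne_zero (sub_ne_zero.2 (ha.injective.ne hne))
        (abs_lt.2 ⟨by linarith [ha0 i, ha1 j], by linarith [ha1 i, ha0 j]⟩)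
    refine mul_ne_zero (mul_ne_zero (Complex.exp_ne_zero _) (Complex.exp_ne_zero _))
      (mul_ne_zero (mul_ne_zero two_ne_zero Complex.I_ne_zero) ?_) h.symm
    exact_mod_cast hsin
  obtain ⟨ρ, hρ, heval⟩ := eval_charpoly_one_add_smul_vecMulVec_star_mul hy hα hchar c v
  set p : Fin n → ℂ := fun j ↦ Complex.exp (π * Complex.I * a j) with hp
  set q : Fin n → ℂ := fun j ↦ Complex.exp (π * Complex.I * b j) with hq
  have hp0 : ∀ j, p j ≠ 0 := fun j ↦ Complex.exp_ne_zero _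
  have hq0 : ∏ k, q k ≠ 0 := Finset.prod_ne_zero_iff.2 fun j _ ↦ Complex.exp_ne_zero _
  have h2I : (2 * Complex.I) ≠ 0 := mul_ne_zero two_ne_zero Complex.I_ne_zero
  refine ⟨-c * (∏ k, p k) / (2 * Complex.I * ∏ k, q k), ρ, hρ, fun j ↦ ?_⟩
  have h := heval j
  have hα2 : Complex.exp (2 * π * Complex.I * a j) = p j * p j := by
    rw [hp, ← Complex.exp_add]; ring_nf
  have hn : n - 1 + 1 = n := Nat.sub_add_cancel (Nat.one_le_of_lt j.2)
  rw [hchar', Polynomial.eval_prod] at h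
  simp only [Polynomial.eval_sub, Polynomial.eval_X, Polynomial.eval_C,
    Complex.exp_sub_exp_eq_sin] at h
  generalize 2 * Complex.I = τ at h h2I ⊢
  simp only [Finset.prod_mul_distrib, Finset.prod_const,
    Finset.card_erase_of_mem (Finset.mem_univ j), Finset.card_univ, Fintype.card_fin, hα2] at h
  rw [← Finset.mul_prod_erase Finset.univ p (Finset.mem_univ j)]
  push_cast
  push_cast at h
  rw [div_mul_eq_mul_div, div_mul_eq_mul_div, eq_div_iff (mul_ne_zero h2I hq0)]
  have hX : p j ^ n * τ ^ (n - 1) ≠ 0 :=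
    mul_ne_zero (pow_ne_zero _ (hp0 j)) (pow_ne_zero _ h2I)
  refine mul_left_cancel₀ hX ?_
  have e1 : p j ^ n = p j ^ (n - 1) * p j := by rw [← pow_succ, hn]
  have e2 : τ ^ n = τ ^ (n - 1) * τ := by
    rw [← pow_succ, hn]
  change p j ^ n * (∏ k, q k) * _ = -c * ρ j * (p j * p j * (p j ^ (n - 1) *
    (∏ k ∈ Finset.univ.erase j, p k) * _)) at h
  rw [e2] at h
  rw [e1] at h ⊢
  linear_combination h

theorem exists_angle_between_of_charpoly {n : ℕ} {y : Matrix (Fin n) (Fin n) ℂ}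
    (hy : y ∈ unitaryGroup (Fin n) ℂ) {a b : Fin n → ℝ} (ha : StrictMono a)
    (ha0 : ∀ j, 0 ≤ a j) (ha1 : ∀ j, a j < 1) (hb0 : ∀ j, 0 ≤ b j) (hb1 : ∀ j, b j < 1)
    (hchar : y.charpoly =
      ∏ j : Fin n, (Polynomial.X - Polynomial.C (Complex.exp (2 * π * Complex.I * (a j)))))
    {c : ℂ} {v : Fin n → ℂ}
    (hchar' : ((1 + c • vecMulVec v (star v)) * y).charpoly =
      ∏ j : Fin n, (Polynomial.X - Polynomial.C (Complex.exp (2 * π * Complex.I * (b j)))))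
    (hab : ∀ j k, a j ≠ b k) (j k : Fin n) (hjk : (j : ℕ) + 1 = k) :
    ∃ l, a j < b l ∧ b l < a k := by
  obtain ⟨d, ρ, hρ, h⟩ := exists_sin_prod_eq_of_charpoly hy ha ha0 ha1 hchar hchar'
  by_contra! hno
  have hlt : j < k := by rw [Fin.lt_def]; lia
  have habs : ∀ i l, |a i - b l| < 1 := fun i l ↦
    abs_lt.2 ⟨by linarith [ha0 i, hb1 l], by linarith [ha1 i, hb0 l]⟩
  have haas : ∀ i l, |a i - a l| < 1 := fun i l ↦
    abs_lt.2 ⟨by linarith [ha0 i, ha1 l], by linarith [ha1 i, ha0 l]⟩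
  set S : Fin n → ℝ := fun i ↦ ∏ l, Real.sin (π * (a i - b l)) with hS
  set T : Fin n → ℝ := fun i ↦ ∏ l ∈ Finset.univ.erase i, Real.sin (π * (a i - a l)) with hT
  have hSS : 0 < S j * S k := by
    rw [hS, ← Finset.prod_mul_distrib]
    refine Finset.prod_pos fun l _ ↦
      Real.sin_pi_mul_mul_sin_pi_mul_pos (habs j l) (habs k l) ?_
    rcases (hab j l).lt_or_gt with hl | hl
    · have := (hno l hl).lt_of_ne (hab k l)
      exact mul_pos_of_neg_of_neg (by linarith) (by linarith)
    · have := ha hlt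
      exact mul_pos (by linarith) (by linarith)
  have hTT : T j * T k < 0 := by
    have hk : k ∈ Finset.univ.erase j := Finset.mem_erase.2 ⟨hlt.ne', Finset.mem_univ _⟩
    have hj : j ∈ Finset.univ.erase k := Finset.mem_erase.2 ⟨hlt.ne, Finset.mem_univ _⟩
    have hpos : 0 < (∏ l ∈ (Finset.univ.erase j).erase k, Real.sin (π * (a j - a l))) *
        ∏ l ∈ (Finset.univ.erase j).erase k, Real.sin (π * (a k - a l)) := by
      rw [← Finset.prod_mul_distrib]
      refine Finset.prod_pos fun l hl ↦
        Real.sin_pi_mul_mul_sin_pi_mul_pos (haas j l) (haas k l) ?_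
      simp only [Finset.mem_erase, Finset.mem_univ, and_true] at hl
      rcases hl.2.lt_or_gt with hlj | hlj
      · have h1 := ha hlj
        have h2 := ha hlt
        exact mul_pos (by linarith) (by linarith)
      · have h1 := ha hlj
        have h2 : a k < a l := ha (by have := hl.1; grind)
        exact mul_pos_of_neg_of_neg (by linarith) (by linarith)
    have hneg := Real.sin_pi_mul_neg (sub_neg.2 (ha hlt)) (abs_lt.1 (haas j k)).1
    have hpos' := Real.sin_pi_mul_pos (sub_pos.2 (ha hlt)) (abs_lt.1 (haas k j)).2
    simp only [hT]
    rw [← Finset.mul_prod_erase _ _ hk, ← Finset.mul_prod_erase _ _ hj,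
      Finset.erase_right_comm (a := k), mul_mul_mul_comm]
    exact mul_neg_of_neg_of_pos (mul_neg_of_neg_of_pos hneg hpos') hpos
  have hprop : S j * (ρ k * T k) = S k * (ρ j * T j) := by
    have : ((S j * (ρ k * T k) : ℝ) : ℂ) = (S k * (ρ j * T j) : ℝ) := by
      push_cast
      rw [h j, h k]
      ring
    exact_mod_cast this
  have hρ0 : ∀ i, S i ≠ 0 → 0 < ρ i := fun i hi ↦ (hρ i).lt_of_ne fun h0 ↦ hi <| by
    have := h i
    rw [← h0, Complex.ofReal_zero, mul_zero, zero_mul] at this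
    exact_mod_cast this
  have hSj := left_ne_zero_of_mul hSS.ne'
  have hTk := right_ne_zero_of_mul hTT.ne
  have hρj := hρ0 j hSj
  have hρk := hρ0 k (right_ne_zero_of_mul hSS.ne')
  have h1 : 0 < S j ^ 2 * T k ^ 2 * ρ k := by positivity
  have h2 : S j ^ 2 * T k ^ 2 * ρ k = (S j * S k) * (T j * T k) * ρ j := by
    linear_combination S j * T k * hprop
  have h3 := mul_neg_of_neg_of_pos (mul_neg_of_pos_of_neg hSS hTT) hρj
  linarith

theorem interlacing_of_exists_between {n : ℕ} {a b : Fin n → ℝ} (ha : StrictMono a)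
    (hb : StrictMono b) (hab : ∀ j k : Fin n, (j : ℕ) + 1 = k → ∃ l, a j < b l ∧ b l < a k)
    (hba : ∀ j k : Fin n, (j : ℕ) + 1 = k → ∃ l, b j < a l ∧ a l < b k)
    (h0 : ∀ i : Fin n, (i : ℕ) = 0 → a i < b i) :
    (∀ j, a j < b j) ∧ ∀ j k : Fin n, (j : ℕ) + 1 = k → b j < a k := by
  have key : ∀ m (hm : m < n), a ⟨m, hm⟩ < b ⟨m, hm⟩ ∧ ∀ l : Fin n, l < ⟨m, hm⟩ →
      b l < a ⟨m, hm⟩ := by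
    intro m
    induction m with
    | zero => exact fun hm ↦ ⟨h0 _ rfl, fun l hl ↦ absurd hl (Nat.not_lt_zero _)⟩
    | succ m ih =>
      intro hm
      have hm' : m < n := Nat.lt_of_succ_lt hm
      obtain ⟨ih1, ih2⟩ := ih hm'
      have hba' : b ⟨m, hm'⟩ < a ⟨m + 1, hm⟩ := by
        obtain ⟨l, hl1, hl2⟩ := hab ⟨m, hm'⟩ ⟨m + 1, hm⟩ rfl
        have hl : ⟨m, hm'⟩ ≤ l := not_lt.1 fun hl ↦ lt_asymm hl1 (ih2 l hl)
        exact (hb.monotone hl).trans_lt hl2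
      refine ⟨?_, fun l hl ↦ (hb.monotone (Nat.le_of_lt_succ hl : l ≤ ⟨m, hm'⟩)).trans_lt hba'⟩
      obtain ⟨l, hl1, hl2⟩ := hba ⟨m, hm'⟩ ⟨m + 1, hm⟩ rfl
      have hl : ⟨m, hm'⟩ < l := ha.lt_iff_lt.1 (ih1.trans hl1)
      exact (ha.monotone (Nat.succ_le_of_lt hl : (⟨m + 1, hm⟩ : Fin n) ≤ l)).trans_lt hl2
  refine ⟨fun j ↦ (key j j.2).1, fun j k hjk ↦ (key k k.2).2 j ?_⟩
  rw [Fin.lt_def]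
  lia

/-- eigenvalue interlacing. Let `x, y` be unitary operators on `ℂⁿ`,
with `x` a complex reflection with eigenvalue-angle list `[x] = (r, 0, …, 0)`,
`0 < r < 1`. Let `[y] = (a₁, …, aₙ)` and `[xy] = (b₁, …, bₙ)` be the eigenvalue-angle
lists, with `a_j < a_{j+1}`, `b_j < b_{j+1}` for `1 ≤ j < n`, and `a_j ≠ b_k` for all
`j, k`. Then either `a₁ < b₁ < a₂ < b₂ < … < aₙ < bₙ` or
`b₁ < a₁ < b₂ < a₂ < … < bₙ < aₙ`. -/
theorem stmt10 (n : ℕ) (x y : Matrix (Fin n) (Fin n) ℂ)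
    (hx : x ∈ Matrix.unitaryGroup (Fin n) ℂ)
    (hy : y ∈ Matrix.unitaryGroup (Fin n) ℂ)
    (r : ℝ) (hr0 : 0 < r) (hr1 : r < 1)
    (hxev : x.charpoly =
      (Polynomial.X - Polynomial.C (Complex.exp (2 * π * Complex.I * r))) *
        (Polynomial.X - 1) ^ (n - 1))
    (a b : Fin n → ℝ) (ha : StrictMono a) (hb : StrictMono b)
    (ha0 : ∀ j, 0 ≤ a j) (ha1 : ∀ j, a j < 1)
    (hb0 : ∀ j, 0 ≤ b j) (hb1 : ∀ j, b j < 1)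
    (hyev : y.charpoly =
      ∏ j : Fin n, (Polynomial.X -
        Polynomial.C (Complex.exp (2 * π * Complex.I * (a j)))))
    (hxyev : (x * y).charpoly =
      ∏ j : Fin n, (Polynomial.X -
        Polynomial.C (Complex.exp (2 * π * Complex.I * (b j)))))
    (hab : ∀ j k, a j ≠ b k) :
    ((∀ j, a j < b j) ∧ ∀ j k : Fin n, (j : ℕ) + 1 = (k : ℕ) → b j < a k) ∨
    ((∀ j, b j < a j) ∧ ∀ j k : Fin n, (j : ℕ) + 1 = (k : ℕ) → a j < b k) := by
  rcases Nat.eq_zero_or_pos n with rfl | hn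
  · exact Or.inl ⟨fun j ↦ j.elim0, fun j ↦ j.elim0⟩
  have hζ : star (Complex.exp (2 * π * Complex.I * r)) * Complex.exp (2 * π * Complex.I * r) =
      1 := by
    rw [RCLike.star_def, ← Complex.exp_conj, ← Complex.exp_add]
    simp [Complex.conj_ofNat]
  obtain ⟨v, hv, rfl⟩ := exists_eq_one_add_smul_vecMulVec_star hn hx hζ hxev
  set ζ := Complex.exp (2 * π * Complex.I * r)
  have hy' : y = (1 + (star ζ - 1) • vecMulVec v (star v)) *
      ((1 + (ζ - 1) • vecMulVec v (star v)) * y) := by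
    rw [← mul_assoc, one_add_smul_vecMulVec_star_mul hv _ _ hζ, one_mul]
  have h1 := exists_angle_between_of_charpoly hy ha ha0 ha1 hb0 hb1 hyev hxyev hab
  have h2 := exists_angle_between_of_charpoly (mul_mem hx hy) hb hb0 hb1 ha0 ha1 hxyev
    (hy' ▸ hyev) (fun j k ↦ (hab k j).symm)
  rcases (hab ⟨0, hn⟩ ⟨0, hn⟩).lt_or_gt with h | h
  · refine Or.inl (interlacing_of_exists_between ha hb h1 h2 fun i hi ↦ ?_)
    rwa [show i = ⟨0, hn⟩ from Fin.ext hi]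
  · refine Or.inr (interlacing_of_exists_between hb ha h2 h1 fun i hi ↦ ?_)
    rwa [show i = ⟨0, hn⟩ from Fin.ext hi]
end

section
/- Let n ≥ 5 and let D be a finite subgroup of the diagonal torus 𝒯 = (ℂ^×)ⁿ ≤ GLₙ(ℂ) which is invariant under conjugation by every permutation matrix corresponding to an element of the alternating group Aₙ. Then D is invariant under conjugation by every permutation matrix corresponding to an element of the symmetric group Sₙ; equivalently, D is a normal subgroup of the full monomial group N = 𝒯·Sₙ (the normalizer of 𝒯 in GLₙ(ℂ)). -/
/-- On at least five points, a subgroup of a power of a commutative group which is invariant under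
even permutations of the coordinates is invariant under transpositions. -/
theorem Subgroup.comp_swap_mem_of_alternatingGroup {α A : Type*} [Fintype α] [DecidableEq α]
    [CommGroup A] (hα : 5 ≤ Fintype.card α) (E : Subgroup (α → A))
    (hE : ∀ σ ∈ alternatingGroup α, ∀ f ∈ E, f ∘ σ ∈ E) {i j : α} (hij : i ≠ j)
    {f : α → A} (hf : f ∈ E) : f ∘ Equiv.swap i j ∈ E := by
  have exists_notMem (s : Finset α) (hs : s.card ≤ 4) : ∃ x, x ∉ s := by
    obtain ⟨x, -, hx⟩ := Finset.exists_mem_notMem_of_card_lt_card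
      (s := s) (t := Finset.univ) (by rw [Finset.card_univ]; omega)
    exact ⟨x, hx⟩
  obtain ⟨k, hk⟩ := exists_notMem {i, j} (Finset.card_le_two.trans (by norm_num))
  obtain ⟨l, hl⟩ := exists_notMem {i, j, k} (Finset.card_le_three.trans (by norm_num))
  obtain ⟨m, hm⟩ := exists_notMem {i, j, k, l} Finset.card_le_four
  simp only [Finset.mem_insert, Finset.mem_singleton, not_or] at hk hl hm
  obtain ⟨hki, hkj⟩ := hk
  obtain ⟨hli, hlj, hlk⟩ := hl
  obtain ⟨hmi, hmj, hmk, hml⟩ := hm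
  have comp_mem {a b c : α} (hab : a ≠ b) (hbc : b ≠ c) {g : α → A} (hg : g ∈ E) :
      g ∘ (Equiv.swap a b * Equiv.swap b c) ∈ E :=
    hE _ (by simp [Equiv.Perm.mem_alternatingGroup, Equiv.Perm.sign_swap hab,
      Equiv.Perm.sign_swap hbc]) g hg
  have hw := E.div_mem hf (comp_mem hij (Ne.symm hkj) hf)
  set w := f / f ∘ (Equiv.swap i j * Equiv.swap j k) with hw_def
  have hwi : w i = f i / f j := by
    simp [hw_def, Equiv.swap_apply_of_ne_of_ne hij (Ne.symm hki)]
  have hw_one (x : α) (hxi : x ≠ i) (hxj : x ≠ j) (hxk : x ≠ k) : w x = 1 := by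
    simp [Equiv.swap_apply_of_ne_of_ne, *]
  have hu := E.div_mem hw (comp_mem (Ne.symm hli) (Ne.symm hml) hw)
  set u := w / w ∘ (Equiv.swap i l * Equiv.swap l m) with hu_def
  have hui : u i = f i / f j := by
    simp [hu_def, Equiv.swap_apply_of_ne_of_ne (Ne.symm hli) (Ne.symm hmi), hwi,
      hw_one l hli hlj hlk]
  have hum : u m = f j / f i := by
    simp [hu_def, hwi, hw_one m hmi hmj hmk]
  have hu_one (x : α) (hxi : x ≠ i) (hxm : x ≠ m) : u x = 1 := by
    by_cases hxl : x = l
    · subst hxl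
      simp [hu_def, Equiv.swap_apply_of_ne_of_ne hmi hml, hw_one x hli hlj hlk,
        hw_one m hmi hmj hmk]
    · simp [Equiv.swap_apply_of_ne_of_ne, *]
  have hv := E.div_mem hf (comp_mem (Ne.symm hmj) hml hu)
  convert hv using 1
  funext x
  by_cases hxi : x = i
  · subst hxi
    simp [Equiv.swap_apply_of_ne_of_ne (Ne.symm hmi) (Ne.symm hli),
      Equiv.swap_apply_of_ne_of_ne hij (Ne.symm hmi), hui]
  by_cases hxj : x = j
  · subst hxj
    simp [Equiv.swap_apply_of_ne_of_ne (Ne.symm hmj) (Ne.symm hlj), hum]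
  rw [Function.comp_apply, Equiv.swap_apply_of_ne_of_ne hxi hxj, Pi.div_apply,
    Function.comp_apply, hu_one, div_one]
  · rw [Ne, ← Equiv.eq_symm_apply]
    simpa [← Equiv.Perm.inv_def, Equiv.swap_apply_of_ne_of_ne hij (Ne.symm hmi),
      Equiv.swap_apply_of_ne_of_ne (Ne.symm hmi) (Ne.symm hli)] using hxi
  · rw [Ne, ← Equiv.eq_symm_apply]
    simpa [← Equiv.Perm.inv_def,
      Equiv.swap_apply_of_ne_of_ne (Ne.symm hmj) (Ne.symm hlj)] using hxj

/-- On at least five points, a subgroup of a power of a commutative group which is invariant under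
even permutations of the coordinates is invariant under all permutations. -/
theorem Subgroup.comp_perm_mem_of_alternatingGroup {α A : Type*} [Fintype α] [DecidableEq α]
    [CommGroup A] (hα : 5 ≤ Fintype.card α) (E : Subgroup (α → A))
    (hE : ∀ σ ∈ alternatingGroup α, ∀ f ∈ E, f ∘ σ ∈ E) (σ : Equiv.Perm α)
    {f : α → A} (hf : f ∈ E) : f ∘ σ ∈ E := by
  induction σ using Equiv.Perm.swap_induction_on generalizing f with
  | one => simpa using hf
  | swap_mul σ i j hij ih =>
    exact ih (E.comp_swap_mem_of_alternatingGroup hα hE hij hf)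

/-- The invertible diagonal matrix with given invertible diagonal entries. -/
def Matrix.GeneralLinearGroup.diagonalHom (n R : Type*) [Fintype n] [DecidableEq n]
    [CommRing R] : (n → Rˣ) →* Matrix.GeneralLinearGroup n R :=
  (Units.map (Matrix.diagonalRingHom n R).toMonoidHom).comp
    MulEquiv.piUnits.symm.toMonoidHom

theorem Matrix.GeneralLinearGroup.coe_diagonalHom {n R : Type*} [Fintype n] [DecidableEq n]
    [CommRing R] (f : n → Rˣ) :
    (diagonalHom n R f : Matrix n n R) = Matrix.diagonal fun i => (f i : R) :=
  rfl

theorem Matrix.GeneralLinearGroup.exists_diagonalHom_eq {n R : Type*} [Fintype n]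
    [DecidableEq n] [CommRing R] (d : Matrix.GeneralLinearGroup n R)
    (hd : (d : Matrix n n R).IsDiag) : ∃ f, diagonalHom n R f = d := by
  have hdet : IsUnit (d : Matrix n n R).det := (Matrix.isUnit_iff_isUnit_det _).1 d.isUnit
  rw [← hd.diagonal_diag, Matrix.det_diagonal, IsUnit.prod_univ_iff] at hdet
  refine ⟨fun i => (hdet i).unit, Units.ext ?_⟩
  rw [coe_diagonalHom]
  exact hd.diagonal_diag

theorem Matrix.GeneralLinearGroup.coe_diagonalHom_comp {n R : Type*} [Fintype n]
    [DecidableEq n] [CommRing R] (f : n → Rˣ) (σ : Equiv.Perm n) :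
    (diagonalHom n R (f ∘ σ) : Matrix n n R) =
      (diagonalHom n R f : Matrix n n R).submatrix σ σ := by
  rw [coe_diagonalHom, coe_diagonalHom, Matrix.submatrix_diagonal_equiv]
  rfl

/-- Let `n ≥ 5` and let `D` be a finite subgroup of the diagonal
torus `𝒯 = (ℂˣ)ⁿ ≤ GLₙ(ℂ)` which is invariant under conjugation by every permutation
matrix corresponding to an element of the alternating group `Aₙ` (conjugation by the
permutation matrix of `σ` sends a diagonal matrix `d` to `d.submatrix σ σ`, i.e. it
permutes the diagonal entries according to `σ`). Then `D` is invariant under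
conjugation by every permutation matrix corresponding to an element of `Sₙ`;
equivalently, `D` is normal in the full monomial group `N = 𝒯·Sₙ`. -/
theorem stmt14 (n : ℕ) (hn : 5 ≤ n)
    (D : Subgroup (Matrix.GeneralLinearGroup (Fin n) ℂ))
    (hDfin : Finite D)
    (hDdiag : ∀ d ∈ D, (d : Matrix (Fin n) (Fin n) ℂ).IsDiag)
    (hA : ∀ σ ∈ alternatingGroup (Fin n), ∀ d ∈ D,
      ∃ d' ∈ D, (d' : Matrix (Fin n) (Fin n) ℂ) =
        (d : Matrix (Fin n) (Fin n) ℂ).submatrix σ σ) :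
    ∀ σ : Equiv.Perm (Fin n), ∀ d ∈ D,
      ∃ d' ∈ D, (d' : Matrix (Fin n) (Fin n) ℂ) =
        (d : Matrix (Fin n) (Fin n) ℂ).submatrix σ σ := by
  intro σ d hd
  obtain ⟨f, rfl⟩ := Matrix.GeneralLinearGroup.exists_diagonalHom_eq d (hDdiag d hd)
  refine ⟨_, ?_, Matrix.GeneralLinearGroup.coe_diagonalHom_comp f σ⟩
  refine Subgroup.comp_perm_mem_of_alternatingGroup
    (E := D.comap (Matrix.GeneralLinearGroup.diagonalHom (Fin n) ℂ))
    (by simpa using hn) (fun τ hτ g hg => ?_) σ hd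
  obtain ⟨d', hd', h⟩ := hA τ hτ _ hg
  rw [← Matrix.GeneralLinearGroup.coe_diagonalHom_comp] at h
  rwa [Subgroup.mem_comap, ← Units.ext h]
end

section
/- Let V be a finite-dimensional complex vector space and let G < GL(V) be a finite subgroup acting irreducibly on V. Suppose G preserves a decomposition V = V₁ ⊕ … ⊕ Vₙ into n one-dimensional subspaces which G permutes, inducing on the set {V₁, …, Vₙ} the symmetric group Sₙ or the alternating group Aₙ, and suppose n ≥ 10. Then G contains a complex bireflection of order 3, i.e., an element conjugate in GL(V) to diag(ω, ω², 1, …, 1) where ω = e^{2πi/3}. -/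
open scoped Real

/-- `g` is conjugate in `GL(V)` to the diagonal matrix with diagonal `f`. -/
def IsConjToDiag {n : ℕ} (g : Matrix (Fin n) (Fin n) ℂ) (f : Fin n → ℂ) : Prop :=
  ∃ P : Matrix (Fin n) (Fin n) ℂ, IsUnit P.det ∧ g = P * Matrix.diagonal f * P⁻¹

/-- A complex bireflection of order 3: an element conjugate to
`diag(ω, ω², 1, …, 1)` with `ω = e^{2πi/3}` a primitive cube root of unity. -/
def IsBireflection3 {n : ℕ} (g : Matrix (Fin n) (Fin n) ℂ) : Prop :=
  IsConjToDiag g (fun i => if (i : ℕ) = 0 then Complex.exp (2 * π * Complex.I / 3)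
    else if (i : ℕ) = 1 then Complex.exp (2 * π * Complex.I / 3) ^ 2 else 1)

/-- `σ` is the 3-cycle `x ↦ y ↦ z ↦ x`. -/
structure IsThreeCycleOn {ι : Type*} (σ : Equiv.Perm ι) (x y z : ι) : Prop where
  map_fst : σ x = y
  map_snd : σ y = z
  map_trd : σ z = x
  map_of_ne : ∀ i, i ≠ x → i ≠ y → i ≠ z → σ i = i

theorem isThreeCycleOn_swap_mul_swap {ι : Type*} [DecidableEq ι] {x y z : ι}
    (hxy : x ≠ y) (hxz : x ≠ z) (hyz : y ≠ z) :
    IsThreeCycleOn (Equiv.swap x y * Equiv.swap y z) x y z := by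
  constructor
  · simp [Equiv.swap_apply_of_ne_of_ne hxy hxz]
  · simp [Equiv.swap_apply_of_ne_of_ne hxz.symm hyz.symm]
  · simp
  · intro i h1 h2 h3
    simp [Equiv.swap_apply_of_ne_of_ne h1 h2, Equiv.swap_apply_of_ne_of_ne h2 h3]

theorem exists_isThreeCycleOn_of_alternatingGroup_le {Γ ι : Type*} [Group Γ] [Fintype ι]
    [DecidableEq ι] (φ : Γ →* Equiv.Perm ι) (hφ : alternatingGroup ι ≤ φ.range) {x y z : ι}
    (hxy : x ≠ y) (hxz : x ≠ z) (hyz : y ≠ z) :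
    ∃ g, IsThreeCycleOn (φ g) x y z := by
  have hmem : Equiv.swap x y * Equiv.swap y z ∈ alternatingGroup ι := by
    simp [Equiv.Perm.mem_alternatingGroup, Equiv.Perm.sign_swap hxy, Equiv.Perm.sign_swap hyz]
  obtain ⟨g, hg⟩ := hφ hmem
  exact ⟨g, hg ▸ isThreeCycleOn_swap_mul_swap hxy hxz hyz⟩

section Cocycle

open scoped commutatorElement

variable {Γ ι A : Type*} [Group Γ] [CommGroup A] {φ : Γ →* Equiv.Perm ι} {c : Γ → ι → A}

theorem cocycle_commutator (hc : ∀ g h i, c (g * h) i = c g (φ h i) * c h i) (a b : Γ) (i : ι) :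
    c ⁅a, b⁆ (φ b (φ a i)) * (c b (φ a i) * c a i) = c a (φ b i) * c b i := by
  have h : ⁅a, b⁆ * (b * a) = a * b := by rw [commutatorElement_def]; group
  have h' := hc ⁅a, b⁆ (b * a) i
  rw [h, hc, hc, map_mul, Equiv.Perm.mul_apply] at h'
  exact h'.symm

theorem map_commutator_apply (a b : Γ) (i : ι) :
    φ ⁅a, b⁆ (φ b (φ a i)) = φ a (φ b i) := by
  have h : ⁅a, b⁆ * (b * a) = a * b := by rw [commutatorElement_def]; group
  have h' := congrArg (fun g => φ g i) h
  simpa only [map_mul, Equiv.Perm.mul_apply] using h'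

variable {a b : Γ} {x y z u v : ι}

theorem IsThreeCycleOn.commutator (ha : IsThreeCycleOn (φ a) x y z)
    (hb : IsThreeCycleOn (φ b) x u v) (hd : [x, y, z, u, v].Nodup) :
    IsThreeCycleOn (φ ⁅a, b⁆) x y u := by
  obtain ⟨a1, a2, a3, a4⟩ := ha
  obtain ⟨b1, b2, b3, b4⟩ := hb
  simp only [List.nodup_cons, List.mem_cons, List.not_mem_nil, or_false, not_or] at hd
  have hk := map_commutator_apply (φ := φ) a b
  generalize φ ⁅a, b⁆ = σ at hk ⊢
  constructor
  · have := hk v; grind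
  · have := hk x; grind
  · have := hk z; grind
  · intro i h1 h2 h3
    by_cases hz : i = z
    · have := hk y; grind
    by_cases hv : i = v
    · have := hk u; grind
    have := hk i
    grind

theorem cocycle_commutator_eq_one_of_ne (hc : ∀ g h i, c (g * h) i = c g (φ h i) * c h i)
    (ha : IsThreeCycleOn (φ a) x y z) (hb : IsThreeCycleOn (φ b) x u v)
    {i : ι} (hi : i ∉ [x, y, z, u, v]) : c ⁅a, b⁆ i = 1 := by
  simp only [List.mem_cons, List.not_mem_nil, or_false, not_or] at hi
  obtain ⟨hx, hy, hz, hu, hv⟩ := hi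
  have h := cocycle_commutator hc a b i
  rw [ha.map_of_ne i hx hy hz, hb.map_of_ne i hx hu hv, mul_comm (c a i)] at h
  exact mul_eq_right.mp h

theorem cocycle_commutator_eq_one (hc : ∀ g h i, c (g * h) i = c g (φ h i) * c h i)
    (ha : IsThreeCycleOn (φ a) x y z) (hb : IsThreeCycleOn (φ b) x u v)
    (hd : [x, y, z, u, v].Nodup) (hau : c a u = 1) (hav : c a v = 1) (hby : c b y = 1)
    (hbz : c b z = 1) {i : ι} (hix : i ≠ x) (hiy : i ≠ y) (hiu : i ≠ u) : c ⁅a, b⁆ i = 1 := by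
  simp only [List.nodup_cons, List.mem_cons, List.not_mem_nil, or_false, not_or] at hd
  have hk := cocycle_commutator hc a b
  by_cases hz : i = z
  · have h := hk y
    rw [ha.map_snd, hb.map_of_ne z (by grind) (by grind) (by grind),
      hb.map_of_ne y (by grind) (by grind) (by grind), hby, hbz] at h
    simpa [hz] using h
  by_cases hv : i = v
  · have h := hk u
    rw [ha.map_of_ne u (by grind) (by grind) (by grind), hb.map_snd, hau, hav] at h
    simpa [hv] using h
  exact cocycle_commutator_eq_one_of_ne hc ha hb (by simp [*])

theorem cocycle_commutator_mul_eq_one (hc : ∀ g h i, c (g * h) i = c g (φ h i) * c h i)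
    (ha : IsThreeCycleOn (φ a) x y z) (hb : IsThreeCycleOn (φ b) x u v)
    (hd : [x, y, z, u, v].Nodup) (hau : c a u = 1) (hav : c a v = 1) (hby : c b y = 1)
    (hbz : c b z = 1) : c ⁅a, b⁆ x * c ⁅a, b⁆ y * c ⁅a, b⁆ u = 1 := by
  simp only [List.nodup_cons, List.mem_cons, List.not_mem_nil, or_false, not_or] at hd
  have hk := cocycle_commutator hc a b
  have h1 := hk v
  rw [ha.map_of_ne v (by grind) (by grind) (by grind), hb.map_trd, hav, mul_one] at h1
  have h2 := hk x
  rw [ha.map_fst, hb.map_fst, hb.map_of_ne y (by grind) (by grind) (by grind), hau, hby,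
    one_mul, one_mul] at h2
  have h3 := hk z
  rw [ha.map_trd, hb.map_fst, hb.map_of_ne z (by grind) (by grind) (by grind), hbz, mul_one,
    ← mul_assoc] at h3
  rw [mul_right_cancel h1, mul_comm (c a x), h2]
  rwa [mul_comm, ← mul_eq_right (b := c a z)]

end Cocycle

theorem isConjToDiag_of_mulVec {n : ℕ} {g : Matrix (Fin n) (Fin n) ℂ} {d : Fin n → ℂ}
    (f : Fin n → Fin n → ℂ) (hf : ⊤ ≤ Submodule.span ℂ (Set.range f))
    (hg : ∀ j, g.mulVec (f j) = d j • f j) : IsConjToDiag g d := by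
  have hli : LinearIndependent ℂ f :=
    linearIndependent_of_top_le_span_of_card_eq_finrank hf (by simp)
  let P : Matrix (Fin n) (Fin n) ℂ := (Matrix.of f).transpose
  have hP : IsUnit P := Matrix.linearIndependent_cols_iff_isUnit.mp hli
  have hP' : IsUnit P.det := (Matrix.isUnit_iff_isUnit_det P).mp hP
  refine ⟨P, hP', ?_⟩
  have h : g * P = P * Matrix.diagonal d := by
    ext i j
    rw [Matrix.mul_diagonal, mul_comm]
    exact congrFun (hg j) i
  rw [← h, Matrix.mul_nonsing_inv_cancel_right _ _ hP']

theorem isBireflection3_of_mulVec {n : ℕ} {g : Matrix (Fin n) (Fin n) ℂ} (e : Fin n → Fin n → ℂ)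
    (he : ⊤ ≤ Submodule.span ℂ (Set.range e)) {x y z : Fin n} (hx : (x : ℕ) = 0)
    (hy : (y : ℕ) = 1) (hz : (z : ℕ) = 2) {p q r : ℂ} (hpqr : p * q * r = 1)
    (hgx : g.mulVec (e x) = p • e y) (hgy : g.mulVec (e y) = q • e z)
    (hgz : g.mulVec (e z) = r • e x)
    (hg : ∀ i, i ≠ x → i ≠ y → i ≠ z → g.mulVec (e i) = e i) : IsBireflection3 g := by
  have hxy : x ≠ y := by grind
  have hxz : x ≠ z := by grind
  have hyz : y ≠ z := by grind
  unfold IsBireflection3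
  set ω := Complex.exp (2 * π * Complex.I / 3) with hω
  have hprim : IsPrimitiveRoot ω 3 := by
    simpa [hω] using Complex.isPrimitiveRoot_exp 3 (by norm_num)
  have h3 : ω ^ 3 = 1 := hprim.pow_eq_one
  have hsum : 1 + ω + ω ^ 2 = 0 := by
    simpa [Finset.sum_range_succ] using hprim.geom_sum_eq_zero (by norm_num)
  have hp : p ≠ 0 := by rintro rfl; simp at hpqr
  have hq : q ≠ 0 := by rintro rfl; simp at hpqr
  -- eigenvector of the 3-cycle block for the eigenvalue `t`, where `s = t⁻¹`
  let w : ℂ → Fin n → ℂ := fun s => e x + (s * p) • e y + (s ^ 2 * (p * q)) • e z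
  have hw : ∀ s t : ℂ, s * t = 1 → s ^ 3 = 1 → g.mulVec (w s) = t • w s := by
    intro s t hst hs
    simp only [w, Matrix.mulVec_add, Matrix.mulVec_smul, hgx, hgy, hgz, smul_add, smul_smul]
    rw [show t * (s * p) = p by linear_combination p * hst,
      show t * (s ^ 2 * (p * q)) = s * p * q by linear_combination s * p * q * hst,
      show s ^ 2 * (p * q) * r = t by
        linear_combination s ^ 2 * hpqr + t * hs - s ^ 2 * hst]
    abel
  let f : Fin n → Fin n → ℂ := fun i =>
    if i = x then w (ω ^ 2) else if i = y then w ω else if i = z then w 1 else e i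
  have fx : f x = w (ω ^ 2) := by simp [f]
  have fy : f y = w ω := by simp [f, hxy.symm]
  have fz : f z = w 1 := by simp [f, hxz.symm, hyz.symm]
  have fi : ∀ i, i ≠ x → i ≠ y → i ≠ z → f i = e i := by
    intro i h1 h2 h3; simp [f, h1, h2, h3]
  refine isConjToDiag_of_mulVec f (he.trans (Submodule.span_le.mpr ?_)) ?_
  · have mem : ∀ i, f i ∈ Submodule.span ℂ (Set.range f) := fun i =>
      Submodule.subset_span ⟨i, rfl⟩
    have comb : ∀ α β γ : ℂ, α • f x + β • f y + γ • f z ∈ Submodule.span ℂ (Set.range f) :=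
      fun α β γ => add_mem (add_mem (Submodule.smul_mem _ _ (mem x))
        (Submodule.smul_mem _ _ (mem y))) (Submodule.smul_mem _ _ (mem z))
    rintro _ ⟨i, rfl⟩
    by_cases h1 : i = x
    · have h : (1 / 3 : ℂ) • f x + (1 / 3 : ℂ) • f y + (1 / 3 : ℂ) • f z = e x := by
        simp only [fx, fy, fz, w]
        match_scalars <;> grind
      exact h1 ▸ h ▸ comb _ _ _
    by_cases h2 : i = y
    · have h : (ω / (3 * p)) • f x + (ω ^ 2 / (3 * p)) • f y + (1 / (3 * p)) • f z = e y := by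
        simp only [fx, fy, fz, w]
        match_scalars <;> grind
      exact h2 ▸ h ▸ comb _ _ _
    by_cases h4 : i = z
    · have h : (ω ^ 2 / (3 * (p * q))) • f x + (ω / (3 * (p * q))) • f y +
          (1 / (3 * (p * q))) • f z = e z := by
        simp only [fx, fy, fz, w]
        match_scalars <;> grind
      exact h4 ▸ h ▸ comb _ _ _
    exact fi i h1 h2 h4 ▸ mem i
  · intro j
    by_cases h1 : j = x
    · rw [h1, fx, hw (ω ^ 2) ω (by linear_combination h3)
        (by linear_combination (ω ^ 3 + 1) * h3)]
      simp [hx]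
    by_cases h2 : j = y
    · rw [h2, fy, hw ω (ω ^ 2) (by linear_combination h3) h3]
      simp [hy]
    by_cases h4 : j = z
    · rw [h4, fz, hw 1 1 (by ring) (by ring)]
      simp [hz]
    rw [fi j h1 h2 h4, hg j h1 h2 h4, if_neg (by grind), if_neg (by grind), one_smul]

open scoped commutatorElement in
/-- A group of monomial transformations inducing at least the alternating group on at least nine
lines contains an element that cyclically permutes the first three basis vectors up to scalars of
product one and fixes the others. -/
theorem exists_isThreeCycleOn_cocycle {n : ℕ} (hn : 9 ≤ n) {Γ A : Type*} [Group Γ] [CommGroup A]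
    {φ : Γ →* Equiv.Perm (Fin n)} (hφ : alternatingGroup (Fin n) ≤ φ.range) {c : Γ → Fin n → A}
    (hc : ∀ g h i, c (g * h) i = c g (φ h i) * c h i) {x y z : Fin n} (hx : (x : ℕ) = 0)
    (hy : (y : ℕ) = 1) (hz : (z : ℕ) = 2) :
    ∃ g, IsThreeCycleOn (φ g) x y z ∧ c g x * c g y * c g z = 1 ∧
      ∀ i, i ≠ x → i ≠ y → i ≠ z → c g i = 1 := by
  let pt : Fin 9 → Fin n := Fin.castLE hn
  have hpt : Function.Injective pt := Fin.castLE_injective hn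
  have cyc : ∀ i j k : Fin 9, i ≠ j → i ≠ k → j ≠ k →
      ∃ g, IsThreeCycleOn (φ g) (pt i) (pt j) (pt k) := fun i j k hij hik hjk =>
    exists_isThreeCycleOn_of_alternatingGroup_le φ hφ (hpt.ne hij) (hpt.ne hik) (hpt.ne hjk)
  have nodup : ∀ l : List (Fin 9), l.Nodup → (l.map pt).Nodup := fun l hl => hl.map hpt
  have notMem : ∀ (i : Fin 9) (l : List (Fin 9)), i ∉ l → pt i ∉ l.map pt := fun i l h => by
    rwa [List.mem_map_of_injective hpt]
  obtain rfl : x = pt 0 := Fin.ext hx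
  obtain rfl : y = pt 1 := Fin.ext hy
  obtain rfl : z = pt 2 := Fin.ext hz
  obtain ⟨a₁, ha₁⟩ := cyc 0 1 5 (by decide) (by decide) (by decide)
  obtain ⟨b₁, hb₁⟩ := cyc 0 3 6 (by decide) (by decide) (by decide)
  obtain ⟨a₂, ha₂⟩ := cyc 0 2 7 (by decide) (by decide) (by decide)
  obtain ⟨b₂, hb₂⟩ := cyc 0 4 8 (by decide) (by decide) (by decide)
  have hk := ha₁.commutator hb₁ (nodup [0, 1, 5, 3, 6] (by decide))
  have hl := ha₂.commutator hb₂ (nodup [0, 2, 7, 4, 8] (by decide))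
  have ck : ∀ i : Fin 9, i ∉ [0, 1, 5, 3, 6] → c ⁅a₁, b₁⁆ (pt i) = 1 := fun i hi =>
    cocycle_commutator_eq_one_of_ne hc ha₁ hb₁ (notMem i [0, 1, 5, 3, 6] hi)
  have cl : ∀ i : Fin 9, i ∉ [0, 2, 7, 4, 8] → c ⁅a₂, b₂⁆ (pt i) = 1 := fun i hi =>
    cocycle_commutator_eq_one_of_ne hc ha₂ hb₂ (notMem i [0, 2, 7, 4, 8] hi)
  have hd := nodup [0, 1, 3, 2, 4] (by decide)
  have k2 := ck 2 (by decide)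
  have k4 := ck 4 (by decide)
  have l1 := cl 1 (by decide)
  have l3 := cl 3 (by decide)
  exact ⟨_, hk.commutator hl hd, cocycle_commutator_mul_eq_one hc hk hl hd k2 k4 l1 l3,
    fun i => cocycle_commutator_eq_one hc hk hl hd k2 k4 l1 l3⟩

/-- Let `G < GL(V)` be a finite subgroup acting irreducibly on a
finite-dimensional complex vector space `V` (here `V = ℂⁿ`). Suppose `G` preserves a
decomposition `V = V₁ ⊕ … ⊕ Vₙ` into `n` one-dimensional subspaces which it permutes,
inducing on `{V₁, …, Vₙ}` the symmetric or the alternating group, and `n ≥ 10`. Then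
`G` contains a complex bireflection of order 3. -/
theorem stmt15 (n : ℕ) (hn : 10 ≤ n)
    (G : Subgroup (Matrix.GeneralLinearGroup (Fin n) ℂ)) (hGfin : Finite G)
    (hirr : ∀ W : Submodule ℂ (Fin n → ℂ),
      (∀ g ∈ G, ∀ w ∈ W, (g : Matrix (Fin n) (Fin n) ℂ).mulVec w ∈ W) →
      W = ⊥ ∨ W = ⊤)
    (V : Fin n → Submodule ℂ (Fin n → ℂ))
    (hV : DirectSum.IsInternal V)
    (hV1 : ∀ i, Module.finrank ℂ (V i) = 1)
    (φ : ↥G →* Equiv.Perm (Fin n))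
    (hφ : ∀ (g : ↥G) (i : Fin n),
      (V i).map (Matrix.toLin'
        ((g : Matrix.GeneralLinearGroup (Fin n) ℂ) : Matrix (Fin n) (Fin n) ℂ))
        = V (φ g i))
    (hφrange : φ.range = ⊤ ∨ φ.range = alternatingGroup (Fin n)) :
    ∃ g ∈ G, IsBireflection3 (g : Matrix (Fin n) (Fin n) ℂ) := by
  have hA : alternatingGroup (Fin n) ≤ φ.range := by
    rcases hφrange with h | h <;> simp [h]
  have hex : ∀ i, ∃ v ∈ V i, v ≠ 0 := fun i =>
    (V i).exists_mem_ne_zero_of_ne_bot fun h => by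
      have := hV1 i
      rw [h, finrank_bot] at this
      exact zero_ne_one this
  choose e heV he0 using hex
  have hVe : ∀ i, V i = Submodule.span ℂ {e i} := fun i => by
    refine le_antisymm (fun v hv => ?_) (by simpa using heV i)
    obtain ⟨t, ht⟩ := exists_smul_eq_of_finrank_eq_one (hV1 i)
      (x := ⟨e i, heV i⟩) (by simpa using he0 i) ⟨v, hv⟩
    exact Submodule.mem_span_singleton.mpr ⟨t, congrArg Subtype.val ht⟩
  have hspan : ⊤ ≤ Submodule.span ℂ (Set.range e) := by
    rw [← hV.submodule_iSup_eq_top, Submodule.span_range_eq_iSup]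
    exact iSup_mono fun i => (hVe i).le
  have hce : ∀ (g : G) (i : Fin n), ∃ t : ℂˣ,
      (g : Matrix.GeneralLinearGroup (Fin n) ℂ).val.mulVec (e i) = (t : ℂ) • e (φ g i) := by
    intro g i
    have hmem : (g : Matrix.GeneralLinearGroup (Fin n) ℂ).val.mulVec (e i) ∈ V (φ g i) := by
      rw [← hφ]
      exact ⟨e i, heV i, rfl⟩
    rw [hVe, Submodule.mem_span_singleton] at hmem
    obtain ⟨t, ht⟩ := hmem
    have ht0 : t ≠ 0 := by
      rintro rfl
      rw [zero_smul] at ht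
      refine he0 i (Matrix.mulVec_injective_of_isUnit
        (g : Matrix.GeneralLinearGroup (Fin n) ℂ).isUnit ?_)
      simp [← ht]
    exact ⟨Units.mk0 t ht0, ht.symm⟩
  choose c hc using hce
  have hmul : ∀ g h i, c (g * h) i = c g (φ h i) * c h i := by
    intro g h i
    have h1 := hc (g * h) i
    rw [Subgroup.coe_mul, Units.val_mul, ← Matrix.mulVec_mulVec, hc, Matrix.mulVec_smul, hc,
      smul_smul, map_mul, Equiv.Perm.mul_apply] at h1
    have h2 := smul_left_injective ℂ (he0 (φ g (φ h i))) h1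
    exact Units.ext (by rw [Units.val_mul, mul_comm]; exact h2.symm)
  obtain ⟨g, hg, hprod, hone⟩ := exists_isThreeCycleOn_cocycle (by omega) hA hmul
    (x := ⟨0, by omega⟩) (y := ⟨1, by omega⟩) (z := ⟨2, by omega⟩) rfl rfl rfl
  refine ⟨g, g.2, isBireflection3_of_mulVec e hspan rfl rfl rfl
    (by simpa using congrArg Units.val hprod) (hg.map_fst ▸ hc g _) (hg.map_snd ▸ hc g _)
    (hg.map_trd ▸ hc g _) fun i h1 h2 h3 => ?_⟩
  rw [hc, hone i h1 h2 h3, hg.map_of_ne i h1 h2 h3, Units.val_one, one_smul]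
end
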